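/- arXiv:1710.04504 — 11 statements merged into one kernel-verified Lean document; each statement's English description precedes it below -/
import Mathlib

section
/- Under the stated hypotheses of an equitorsion third-type almost geodesic mapping with the property of reciprocity, at every point of U and for all indices i,j,m,n: Γ̄^i_[jm];̄n = Γ^i_[jm];n + σ̄_(1)^i_{jmn} − σ_(1)^i_{jmn} (the case p = 1 of the transformation rule for the covariant derivative of the torsion tensor), where ';' and ';̄' denote the covariant derivatives determined by the symmetric parts of Γ and Γ̄ respectively. -/
open scoped BigOperators

noncomputable section

/-- Partial derivative of a real-valued function on `ℝ^N` in the `n`-th coordinate direction. -/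
def pder {N : ℕ} (f : (Fin N → ℝ) → ℝ) (n : Fin N) (x : Fin N → ℝ) : ℝ :=
  fderiv ℝ f x (Pi.single n 1)

/-- Kronecker delta `δ^i_j`. -/
def kd {N : ℕ} (i j : Fin N) : ℝ := if i = j then 1 else 0

/-- Symmetric part `Γ^i_(jk)` of a generalized affine connection. -/
def GamS {N : ℕ} (Γ : (Fin N → ℝ) → Fin N → Fin N → Fin N → ℝ)
    (x : Fin N → ℝ) (i j k : Fin N) : ℝ :=
  (Γ x i j k + Γ x i k j) / 2

/-- Torsion `Γ^i_[jk]` of a generalized affine connection. -/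
def GamT {N : ℕ} (Γ : (Fin N → ℝ) → Fin N → Fin N → Fin N → ℝ)
    (x : Fin N → ℝ) (i j k : Fin N) : ℝ :=
  (Γ x i j k - Γ x i k j) / 2

/-- Covariant derivative `Γ^i_[jm];n` of the torsion tensor, taken with respect to the
symmetric part of `Γ` (the rule for (1,2)-fields applied to the torsion). -/
def covTor {N : ℕ} (Γ : (Fin N → ℝ) → Fin N → Fin N → Fin N → ℝ)
    (x : Fin N → ℝ) (i j m n : Fin N) : ℝ :=
  pder (fun y => GamT Γ y i j m) n x
    + (∑ α, GamS Γ x i α n * GamT Γ x α j m)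
    - (∑ α, GamS Γ x α j n * GamT Γ x i α m)
    - (∑ α, GamS Γ x α m n * GamT Γ x i j α)

/-- The twenty geometric objects `U1, …, U20` (0-indexed as `Uobj … 0, …, Uobj … 19`). -/
def Uobj {N : ℕ} (Γ : (Fin N → ℝ) → Fin N → Fin N → Fin N → ℝ)
    (σ : (Fin N → ℝ) → Fin N → Fin N → ℝ) (φ : (Fin N → ℝ) → Fin N → ℝ)
    (x : Fin N → ℝ) (i j m n : Fin N) : Fin 20 → ℝ :=
  ![(∑ α, GamT Γ x α j m * GamS Γ x i α n),
    (∑ α, GamT Γ x α j n * GamS Γ x i α m),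
    (∑ α, GamT Γ x i α m * GamS Γ x α j n),
    (∑ α, GamT Γ x i α n * GamS Γ x α j m),
    (∑ α, GamT Γ x i j α * GamS Γ x α m n),
    (GamT Γ x i j m * ∑ α, GamS Γ x α n α),
    (GamT Γ x i j n * ∑ α, GamS Γ x α m α),
    (GamT Γ x i m n * ∑ α, GamS Γ x α j α),
    ((∑ α, GamT Γ x i α m * φ x α) * σ x j n),
    ((∑ α, GamT Γ x i α n * φ x α) * σ x j m),
    ((∑ α, GamT Γ x i j α * φ x α) * σ x m n),
    (GamT Γ x i j m * ∑ α, φ x α * σ x α n),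
    (GamT Γ x i j n * ∑ α, φ x α * σ x α m),
    (GamT Γ x i m n * ∑ α, φ x α * σ x α j),
    (kd i n * ∑ α, GamT Γ x α j m * ∑ β, GamS Γ x β α β),
    (kd i m * ∑ α, GamT Γ x α j n * ∑ β, GamS Γ x β α β),
    (kd i n * ∑ α, GamT Γ x α j m * ∑ β, φ x β * σ x α β),
    (kd i m * ∑ α, GamT Γ x α j n * ∑ β, φ x β * σ x α β),
    ((∑ α, GamT Γ x α j m * σ x α n) * φ x i),
    ((∑ α, GamT Γ x α j n * σ x α m) * φ x i)]

/-- The deformation objects `σ_(p)`, `p = 1, …, 8` (0-indexed: `sigmaP … 0 = σ_(1)`, …,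
`sigmaP … 7 = σ_(8)`), expressed through `U1, …, U20` with `c = 1/(N+1)`. -/
def sigmaP {N : ℕ} (Γ : (Fin N → ℝ) → Fin N → Fin N → Fin N → ℝ)
    (σ : (Fin N → ℝ) → Fin N → Fin N → ℝ) (φ : (Fin N → ℝ) → Fin N → ℝ)
    (p : Fin 8) (x : Fin N → ℝ) (i j m n : Fin N) : ℝ :=
  let c : ℝ := 1 / ((N : ℝ) + 1)
  let u : Fin 20 → ℝ := Uobj Γ σ φ x i j m n
  ![(u 0 - u 2 - u 4),
    (u 0 + u 8 + u 10 - c * (2 * u 5 + u 6 - u 7) - c * (2 * u 11 + u 12 - u 13)),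
    (u 0 - u 2 + u 10 - c * (u 5 + u 6 + u 11 + u 12)),
    (u 0 - u 4 + u 8 - c * (u 5 - u 7 + u 11 - u 13)),
    (-u 18 - u 2 - u 4 + c * (u 14 + u 5 + u 16 + u 11)),
    (-u 18 + u 8 + u 10 + c * (u 14 - u 5 - u 6 + u 7) + c * (u 16 - u 11 - u 12 + u 13)),
    (-u 18 - u 2 + u 10 + c * (u 14 - u 6 + u 16 - u 12)),
    (-u 18 - u 4 + u 8 + c * (u 14 + u 7 + u 16 + u 13))] p

/-- the case `p = 1` of the transformation rule for the covariant
derivative of the torsion tensor under an equitorsion third-type almost geodesic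
mapping with the property of reciprocity. -/
theorem stmt2 {N : ℕ} (hN : 2 ≤ N)
    (U : Set (Fin N → ℝ)) (hUopen : IsOpen U) (hUne : U.Nonempty)
    (Γ Γ' : (Fin N → ℝ) → Fin N → Fin N → Fin N → ℝ)
    (hΓ : ∀ i j k, ContDiffOn ℝ 2 (fun x => Γ x i j k) U)
    (hΓ' : ∀ i j k, ContDiffOn ℝ 2 (fun x => Γ' x i j k) U)
    (ψ φ : (Fin N → ℝ) → Fin N → ℝ) (σ : (Fin N → ℝ) → Fin N → Fin N → ℝ)
    (ψ' φ' : (Fin N → ℝ) → Fin N → ℝ) (σ' : (Fin N → ℝ) → Fin N → Fin N → ℝ)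
    (hψ : ∀ j, ContDiffOn ℝ 2 (fun x => ψ x j) U)
    (hφ : ∀ i, ContDiffOn ℝ 2 (fun x => φ x i) U)
    (hσ : ∀ j k, ContDiffOn ℝ 2 (fun x => σ x j k) U)
    (hσsym : ∀ x ∈ U, ∀ j k, σ x j k = σ x k j)
    (hψ' : ∀ j, ContDiffOn ℝ 2 (fun x => ψ' x j) U)
    (hφ' : ∀ i, ContDiffOn ℝ 2 (fun x => φ' x i) U)
    (hσ' : ∀ j k, ContDiffOn ℝ 2 (fun x => σ' x j k) U)
    (hσ'sym : ∀ x ∈ U, ∀ j k, σ' x j k = σ' x k j)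
    (hbasic : ∀ x ∈ U, ∀ i j k,
      Γ' x i j k = Γ x i j k + ψ x j * kd i k + ψ x k * kd i j + 2 * σ x j k * φ x i)
    (hrecip : ∀ x ∈ U, ∀ i j k,
      Γ x i j k = Γ' x i j k + ψ' x j * kd i k + ψ' x k * kd i j + 2 * σ' x j k * φ' x i)
    (hψneg : ∀ x ∈ U, ∀ j, ψ' x j = -ψ x j)
    (hσφneg : ∀ x ∈ U, ∀ i j k, σ' x j k * φ' x i = -(σ x j k * φ x i)) :
    ∀ x ∈ U, ∀ i j m n : Fin N,
      covTor Γ' x i j m n =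
        covTor Γ x i j m n + sigmaP Γ' σ' φ' 0 x i j m n - sigmaP Γ σ φ 0 x i j m n := by
  intro x hx i j m n
  have hT : ∀ y ∈ U, GamT Γ' y i j m = GamT Γ y i j m := by
    intro y hy
    simp only [GamT]
    rw [hbasic y hy i j m, hbasic y hy i m j, hσsym y hy j m]
    ring
  have hp : pder (fun y => GamT Γ' y i j m) n x = pder (fun y => GamT Γ y i j m) n x := by
    unfold pder
    have he : (fun y => GamT Γ' y i j m) =ᶠ[nhds x] (fun y => GamT Γ y i j m) :=
      Filter.eventuallyEq_of_mem (hUopen.mem_nhds hx) hT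
    rw [he.fderiv_eq]
  have key : ∀ (G : (Fin N → ℝ) → Fin N → Fin N → Fin N → ℝ)
      (s : (Fin N → ℝ) → Fin N → Fin N → ℝ) (f : (Fin N → ℝ) → Fin N → ℝ),
      covTor G x i j m n = pder (fun y => GamT G y i j m) n x + sigmaP G s f 0 x i j m n := by
    intro G s f
    have hs : sigmaP G s f 0 x i j m n = (∑ α, GamT G x α j m * GamS G x i α n)
        - (∑ α, GamT G x i α m * GamS G x α j n)
        - (∑ α, GamT G x i j α * GamS G x α m n) := rfl
    rw [hs]
    simp only [covTor, mul_comm (GamT G x _ _ _)]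
    ring
  rw [key Γ' σ' φ', key Γ σ φ, hp]
  ring
end
end

section
/- Under the stated hypotheses of an equitorsion third-type almost geodesic mapping with the property of reciprocity, at every point of U and for all indices i,j,m,n: Γ̄^i_[jm];̄n = Γ^i_[jm];n + σ̄_(2)^i_{jmn} − σ_(2)^i_{jmn} (the case p = 2 of the transformation rule for the covariant derivative of the torsion tensor), where ';' and ';̄' denote the covariant derivatives determined by the symmetric parts of Γ and Γ̄ respectively. -/
open scoped BigOperators

noncomputable section

/-- the case `p = 2` of the transformation rule for the covariant
derivative of the torsion tensor under an equitorsion third-type almost geodesic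
mapping with the property of reciprocity. -/
theorem stmt3 {N : ℕ} (hN : 2 ≤ N)
    (U : Set (Fin N → ℝ)) (hUopen : IsOpen U) (hUne : U.Nonempty)
    (Γ Γ' : (Fin N → ℝ) → Fin N → Fin N → Fin N → ℝ)
    (hΓ : ∀ i j k, ContDiffOn ℝ 2 (fun x => Γ x i j k) U)
    (hΓ' : ∀ i j k, ContDiffOn ℝ 2 (fun x => Γ' x i j k) U)
    (ψ φ : (Fin N → ℝ) → Fin N → ℝ) (σ : (Fin N → ℝ) → Fin N → Fin N → ℝ)
    (ψ' φ' : (Fin N → ℝ) → Fin N → ℝ) (σ' : (Fin N → ℝ) → Fin N → Fin N → ℝ)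
    (hψ : ∀ j, ContDiffOn ℝ 2 (fun x => ψ x j) U)
    (hφ : ∀ i, ContDiffOn ℝ 2 (fun x => φ x i) U)
    (hσ : ∀ j k, ContDiffOn ℝ 2 (fun x => σ x j k) U)
    (hσsym : ∀ x ∈ U, ∀ j k, σ x j k = σ x k j)
    (hψ' : ∀ j, ContDiffOn ℝ 2 (fun x => ψ' x j) U)
    (hφ' : ∀ i, ContDiffOn ℝ 2 (fun x => φ' x i) U)
    (hσ' : ∀ j k, ContDiffOn ℝ 2 (fun x => σ' x j k) U)
    (hσ'sym : ∀ x ∈ U, ∀ j k, σ' x j k = σ' x k j)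
    (hbasic : ∀ x ∈ U, ∀ i j k,
      Γ' x i j k = Γ x i j k + ψ x j * kd i k + ψ x k * kd i j + 2 * σ x j k * φ x i)
    (hrecip : ∀ x ∈ U, ∀ i j k,
      Γ x i j k = Γ' x i j k + ψ' x j * kd i k + ψ' x k * kd i j + 2 * σ' x j k * φ' x i)
    (hψneg : ∀ x ∈ U, ∀ j, ψ' x j = -ψ x j)
    (hσφneg : ∀ x ∈ U, ∀ i j k, σ' x j k * φ' x i = -(σ x j k * φ x i)) :
    ∀ x ∈ U, ∀ i j m n : Fin N,
      covTor Γ' x i j m n =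
        covTor Γ x i j m n + sigmaP Γ' σ' φ' 1 x i j m n - sigmaP Γ σ φ 1 x i j m n := by
  intro x hx i j m n
  have hT : ∀ y ∈ U, ∀ a b c, GamT Γ' y a b c = GamT Γ y a b c := by
    intro y hy a b c
    simp only [GamT, hbasic y hy]
    rw [hσsym y hy c b]
    ring
  have hS : ∀ a b c, GamS Γ' x a b c
      = GamS Γ x a b c + ψ x b * kd a c + ψ x c * kd a b + 2 * (σ x b c * φ x a) := by
    intro a b c
    simp only [GamS, hbasic x hx]
    rw [hσsym x hx c b]
    ring
  have hP : pder (fun y => GamT Γ' y i j m) n x = pder (fun y => GamT Γ y i j m) n x := by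
    unfold pder
    rw [Filter.EventuallyEq.fderiv_eq]
    filter_upwards [hUopen.mem_nhds hx] with y hy
    exact hT y hy i j m
  have hN1 : (N : ℝ) + 1 ≠ 0 := by positivity
  -- contraction of the symmetric part
  have htr : ∀ b, ∑ α, GamS Γ' x α b α
      = (∑ α, GamS Γ x α b α) + ((N : ℝ) + 1) * ψ x b + 2 * ∑ α, φ x α * σ x α b := by
    intro b
    simp only [hS, Finset.sum_add_distrib, ← Finset.mul_sum]
    have h1 : ∑ α : Fin N, ψ x b * kd α α = N * ψ x b := by simp [kd]
    have h2 : ∑ α : Fin N, ψ x α * kd α b = ψ x b := by simp [kd]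
    have h3 : ∑ α, σ x b α * φ x α = ∑ α, φ x α * σ x α b :=
      Finset.sum_congr rfl fun α _ => by rw [hσsym x hx b α, mul_comm]
    have h1' : ψ x b * ∑ α : Fin N, kd α α = N * ψ x b := by simp [kd, mul_comm]
    rw [h2, h3, h1']
    ring
  have hφσ : ∀ b, ∑ α, φ' x α * σ' x α b = -∑ α, φ x α * σ x α b := by
    intro b
    rw [← Finset.sum_neg_distrib]
    refine Finset.sum_congr rfl fun α _ => ?_
    rw [mul_comm, hσφneg x hx, mul_comm]
  have hTφ : ∀ (t : Fin N → ℝ) b c, (∑ α, t α * φ' x α) * σ' x b c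
      = -((∑ α, t α * φ x α) * σ x b c) := by
    intro t b c
    rw [Finset.sum_mul, Finset.sum_mul, ← Finset.sum_neg_distrib]
    refine Finset.sum_congr rfl fun α _ => ?_
    linear_combination t α * hσφneg x hx α b c
  have hST : ∀ (t : Fin N → ℝ) b c, ∑ α, GamS Γ' x α b c * t α
      = (∑ α, GamS Γ x α b c * t α) + ψ x b * t c + ψ x c * t b
        + 2 * ((∑ α, t α * φ x α) * σ x b c) := by
    intro t b c
    have h1 : ∀ b c, ∑ α : Fin N, ψ x b * kd α c * t α = ψ x b * t c := by
      intro b c; simp [kd]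
    rw [← h1 b c, ← h1 c b, Finset.sum_mul, Finset.mul_sum, ← Finset.sum_add_distrib,
      ← Finset.sum_add_distrib, ← Finset.sum_add_distrib]
    refine Finset.sum_congr rfl fun α _ => ?_
    rw [hS]; ring
  have hcomm : ∀ G : (Fin N → ℝ) → Fin N → Fin N → Fin N → ℝ,
      ∑ α, GamS G x i α n * GamT Γ x α j m = ∑ α, GamT Γ x α j m * GamS G x i α n :=
    fun G => Finset.sum_congr rfl fun α _ => mul_comm _ _
  have hanti : GamT Γ x i n m = -GamT Γ x i m n := by unfold GamT; ring
  have e : ∀ (G : (Fin N → ℝ) → Fin N → Fin N → Fin N → ℝ)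
      (s : (Fin N → ℝ) → Fin N → Fin N → ℝ) (f : (Fin N → ℝ) → Fin N → ℝ),
      sigmaP G s f 1 x i j m n =
        (∑ α, GamT G x α j m * GamS G x i α n)
        + (∑ α, GamT G x i α m * f x α) * s x j n
        + (∑ α, GamT G x i j α * f x α) * s x m n
        - 1 / ((N : ℝ) + 1) * (2 * (GamT G x i j m * ∑ α, GamS G x α n α)
          + (GamT G x i j n * ∑ α, GamS G x α m α) - (GamT G x i m n * ∑ α, GamS G x α j α))
        - 1 / ((N : ℝ) + 1) * (2 * (GamT G x i j m * ∑ α, f x α * s x α n)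
          + (GamT G x i j n * ∑ α, f x α * s x α m)
          - (GamT G x i m n * ∑ α, f x α * s x α j)) := fun G s f => rfl
  rw [e, e]
  unfold covTor
  rw [hP]
  simp only [hT x hx]
  rw [hcomm, hcomm, hST (fun α => GamT Γ x i α m), hST (fun α => GamT Γ x i j α),
    hTφ (fun α => GamT Γ x i α m), hTφ (fun α => GamT Γ x i j α)]
  simp only [htr, hφσ, hanti]
  field_simp
  ring
end
end

section
/- Under the stated hypotheses of an equitorsion third-type almost geodesic mapping with the property of reciprocity, at every point of U and for all indices i,j,m,n: Γ̄^i_[jm];̄n = Γ^i_[jm];n + σ̄_(3)^i_{jmn} − σ_(3)^i_{jmn} (the case p = 3 of the transformation rule for the covariant derivative of the torsion tensor), where ';' and ';̄' denote the covariant derivatives determined by the symmetric parts of Γ and Γ̄ respectively. -/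
open scoped BigOperators

noncomputable section

/-- the case `p = 3` of the transformation rule for the covariant
derivative of the torsion tensor under an equitorsion third-type almost geodesic
mapping with the property of reciprocity. -/
theorem stmt4 {N : ℕ} (hN : 2 ≤ N)
    (U : Set (Fin N → ℝ)) (hUopen : IsOpen U) (hUne : U.Nonempty)
    (Γ Γ' : (Fin N → ℝ) → Fin N → Fin N → Fin N → ℝ)
    (hΓ : ∀ i j k, ContDiffOn ℝ 2 (fun x => Γ x i j k) U)
    (hΓ' : ∀ i j k, ContDiffOn ℝ 2 (fun x => Γ' x i j k) U)
    (ψ φ : (Fin N → ℝ) → Fin N → ℝ) (σ : (Fin N → ℝ) → Fin N → Fin N → ℝ)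
    (ψ' φ' : (Fin N → ℝ) → Fin N → ℝ) (σ' : (Fin N → ℝ) → Fin N → Fin N → ℝ)
    (hψ : ∀ j, ContDiffOn ℝ 2 (fun x => ψ x j) U)
    (hφ : ∀ i, ContDiffOn ℝ 2 (fun x => φ x i) U)
    (hσ : ∀ j k, ContDiffOn ℝ 2 (fun x => σ x j k) U)
    (hσsym : ∀ x ∈ U, ∀ j k, σ x j k = σ x k j)
    (hψ' : ∀ j, ContDiffOn ℝ 2 (fun x => ψ' x j) U)
    (hφ' : ∀ i, ContDiffOn ℝ 2 (fun x => φ' x i) U)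
    (hσ' : ∀ j k, ContDiffOn ℝ 2 (fun x => σ' x j k) U)
    (hσ'sym : ∀ x ∈ U, ∀ j k, σ' x j k = σ' x k j)
    (hbasic : ∀ x ∈ U, ∀ i j k,
      Γ' x i j k = Γ x i j k + ψ x j * kd i k + ψ x k * kd i j + 2 * σ x j k * φ x i)
    (hrecip : ∀ x ∈ U, ∀ i j k,
      Γ x i j k = Γ' x i j k + ψ' x j * kd i k + ψ' x k * kd i j + 2 * σ' x j k * φ' x i)
    (hψneg : ∀ x ∈ U, ∀ j, ψ' x j = -ψ x j)
    (hσφneg : ∀ x ∈ U, ∀ i j k, σ' x j k * φ' x i = -(σ x j k * φ x i)) :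
    ∀ x ∈ U, ∀ i j m n : Fin N,
      covTor Γ' x i j m n =
        covTor Γ x i j m n + sigmaP Γ' σ' φ' 2 x i j m n - sigmaP Γ σ φ 2 x i j m n := by
  intro x hx i j m n
  have hT : ∀ y ∈ U, ∀ a b d, GamT Γ' y a b d = GamT Γ y a b d := by
    intro y hy a b d
    simp only [GamT]
    rw [hbasic y hy a b d, hbasic y hy a d b, hσsym y hy d b]
    ring
  have hS : ∀ a b d, GamS Γ' x a b d =
      GamS Γ x a b d + (ψ x b * kd a d + ψ x d * kd a b + 2 * σ x b d * φ x a) := by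
    intro a b d
    simp only [GamS]
    rw [hbasic x hx a b d, hbasic x hx a d b, hσsym x hx d b]
    ring
  have hp : pder (fun y => GamT Γ' y i j m) n x = pder (fun y => GamT Γ y i j m) n x := by
    unfold pder
    have : (fun y => GamT Γ' y i j m) =ᶠ[nhds x] (fun y => GamT Γ y i j m) := by
      filter_upwards [hUopen.mem_nhds hx] with y hy
      exact hT y hy i j m
    rw [this.fderiv_eq]
  have e3 : ∀ (G : (Fin N → ℝ) → Fin N → Fin N → Fin N → ℝ) (s : (Fin N → ℝ) → Fin N → Fin N → ℝ)
      (f : (Fin N → ℝ) → Fin N → ℝ), sigmaP G s f 2 x i j m n =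
      (∑ α, GamT G x α j m * GamS G x i α n) - (∑ α, GamT G x i α m * GamS G x α j n)
      + ((∑ α, GamT G x i j α * f x α) * s x m n)
      - 1 / ((N : ℝ) + 1) * ((GamT G x i j m * ∑ α, GamS G x α n α)
        + (GamT G x i j n * ∑ α, GamS G x α m α)
        + (GamT G x i j m * ∑ α, f x α * s x α n)
        + (GamT G x i j n * ∑ α, f x α * s x α m)) := by
    intro G s f
    rfl
  have hc : ∀ (G : (Fin N → ℝ) → Fin N → Fin N → Fin N → ℝ), covTor G x i j m n =
      pder (fun y => GamT G y i j m) n x + (∑ α, GamT G x α j m * GamS G x i α n)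
      - (∑ α, GamT G x i α m * GamS G x α j n) - (∑ α, GamS G x α m n * GamT G x i j α) := by
    intro G
    simp only [covTor, mul_comm]
  -- the trace of the deformation tensor
  have htr : ∀ k, (∑ α, GamS Γ' x α k α) =
      (∑ α, GamS Γ x α k α) + ((N : ℝ) + 1) * ψ x k + 2 * ∑ α, φ x α * σ x α k := by
    intro k
    simp only [hS, Finset.sum_add_distrib]
    have h1 : ∑ α : Fin N, ψ x k * kd α α = (N : ℝ) * ψ x k := by
      simp [kd]
    have h2 : ∑ α : Fin N, ψ x α * kd α k = ψ x k := by
      simp [kd]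
    have h3 : ∑ α : Fin N, 2 * σ x k α * φ x α = 2 * ∑ α, φ x α * σ x α k := by
      rw [Finset.mul_sum]
      refine Finset.sum_congr rfl fun α _ => ?_
      rw [hσsym x hx k α]
      ring
    rw [h1, h2, h3]
    ring
  have hφσ : ∀ k, (∑ α, φ' x α * σ' x α k) = - ∑ α, φ x α * σ x α k := by
    intro k
    rw [← Finset.sum_neg_distrib]
    refine Finset.sum_congr rfl fun α _ => ?_
    have := hσφneg x hx α α k
    linarith
  have hTφ : (∑ α, GamT Γ x i j α * φ' x α) * σ' x m n =
      -((∑ α, GamT Γ x i j α * φ x α) * σ x m n) := by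
    rw [Finset.sum_mul, Finset.sum_mul, ← Finset.sum_neg_distrib]
    refine Finset.sum_congr rfl fun α _ => ?_
    have := hσφneg x hx α m n
    linear_combination GamT Γ x i j α * this
  have hST : (∑ α, GamS Γ' x α m n * GamT Γ x i j α) =
      (∑ α, GamS Γ x α m n * GamT Γ x i j α) + ψ x m * GamT Γ x i j n + ψ x n * GamT Γ x i j m
      + 2 * ((∑ α, GamT Γ x i j α * φ x α) * σ x m n) := by
    have h1 : ψ x m * GamT Γ x i j n = ∑ α, ψ x m * kd α n * GamT Γ x i j α := by
      simp [kd]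
    have h2 : ψ x n * GamT Γ x i j m = ∑ α, ψ x n * kd α m * GamT Γ x i j α := by
      simp [kd]
    rw [h1, h2, Finset.sum_mul, Finset.mul_sum, ← Finset.sum_add_distrib,
      ← Finset.sum_add_distrib, ← Finset.sum_add_distrib]
    refine Finset.sum_congr rfl fun α _ => ?_
    rw [hS]
    ring
  have hN1 : (N : ℝ) + 1 ≠ 0 := by positivity
  rw [hc, hc, e3, e3, hp]
  simp only [hT x hx]
  rw [htr, htr, hφσ, hφσ, hTφ, hST]
  field_simp
  ring
end
end

section
/- Under the stated hypotheses of an equitorsion third-type almost geodesic mapping with the property of reciprocity, at every point of U and for all indices i,j,m,n: Γ̄^i_[jm];̄n = Γ^i_[jm];n + σ̄_(4)^i_{jmn} − σ_(4)^i_{jmn} (the case p = 4 of the transformation rule for the covariant derivative of the torsion tensor), where ';' and ';̄' denote the covariant derivatives determined by the symmetric parts of Γ and Γ̄ respectively. -/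
open scoped BigOperators

noncomputable section

/-- the case `p = 4` of the transformation rule for the covariant
derivative of the torsion tensor under an equitorsion third-type almost geodesic
mapping with the property of reciprocity. -/
theorem stmt5 {N : ℕ} (hN : 2 ≤ N)
    (U : Set (Fin N → ℝ)) (hUopen : IsOpen U) (hUne : U.Nonempty)
    (Γ Γ' : (Fin N → ℝ) → Fin N → Fin N → Fin N → ℝ)
    (hΓ : ∀ i j k, ContDiffOn ℝ 2 (fun x => Γ x i j k) U)
    (hΓ' : ∀ i j k, ContDiffOn ℝ 2 (fun x => Γ' x i j k) U)
    (ψ φ : (Fin N → ℝ) → Fin N → ℝ) (σ : (Fin N → ℝ) → Fin N → Fin N → ℝ)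
    (ψ' φ' : (Fin N → ℝ) → Fin N → ℝ) (σ' : (Fin N → ℝ) → Fin N → Fin N → ℝ)
    (hψ : ∀ j, ContDiffOn ℝ 2 (fun x => ψ x j) U)
    (hφ : ∀ i, ContDiffOn ℝ 2 (fun x => φ x i) U)
    (hσ : ∀ j k, ContDiffOn ℝ 2 (fun x => σ x j k) U)
    (hσsym : ∀ x ∈ U, ∀ j k, σ x j k = σ x k j)
    (hψ' : ∀ j, ContDiffOn ℝ 2 (fun x => ψ' x j) U)
    (hφ' : ∀ i, ContDiffOn ℝ 2 (fun x => φ' x i) U)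
    (hσ' : ∀ j k, ContDiffOn ℝ 2 (fun x => σ' x j k) U)
    (hσ'sym : ∀ x ∈ U, ∀ j k, σ' x j k = σ' x k j)
    (hbasic : ∀ x ∈ U, ∀ i j k,
      Γ' x i j k = Γ x i j k + ψ x j * kd i k + ψ x k * kd i j + 2 * σ x j k * φ x i)
    (hrecip : ∀ x ∈ U, ∀ i j k,
      Γ x i j k = Γ' x i j k + ψ' x j * kd i k + ψ' x k * kd i j + 2 * σ' x j k * φ' x i)
    (hψneg : ∀ x ∈ U, ∀ j, ψ' x j = -ψ x j)
    (hσφneg : ∀ x ∈ U, ∀ i j k, σ' x j k * φ' x i = -(σ x j k * φ x i)) :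
    ∀ x ∈ U, ∀ i j m n : Fin N,
      covTor Γ' x i j m n =
        covTor Γ x i j m n + sigmaP Γ' σ' φ' 3 x i j m n - sigmaP Γ σ φ 3 x i j m n := by
  intro x hx i j m n
  have hT : ∀ y ∈ U, ∀ a b c, GamT Γ' y a b c = GamT Γ y a b c := by
    intro y hy a b c
    simp only [GamT, hbasic y hy, hσsym y hy c b]
    ring
  have hS : ∀ a b c, GamS Γ' x a b c
      = GamS Γ x a b c + (ψ x b * kd a c + ψ x c * kd a b + 2 * (σ x b c * φ x a)) := by
    intro a b c
    simp only [GamS, hbasic x hx, hσsym x hx c b]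
    ring
  have hp : pder (fun y => GamT Γ' y i j m) n x = pder (fun y => GamT Γ y i j m) n x := by
    unfold pder
    have h : (fun y => GamT Γ' y i j m) =ᶠ[nhds x] (fun y => GamT Γ y i j m) := by
      filter_upwards [hUopen.mem_nhds hx] with y hy using hT y hy i j m
    rw [h.fderiv_eq]
  have hTa : GamT Γ x i n m = - GamT Γ x i m n := by
    unfold GamT
    ring
  have hN1 : (N : ℝ) + 1 ≠ 0 := by positivity
  -- the trace of the deformation
  have htr : ∀ k, (∑ α, GamS Γ' x α k α) + (∑ α, φ' x α * σ' x α k)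
      = (∑ α, GamS Γ x α k α) + (∑ α, φ x α * σ x α k) + ((N : ℝ) + 1) * ψ x k := by
    intro k
    have h1 : ∀ α, φ' x α * σ' x α k = -(φ x α * σ x α k) := by
      intro α
      rw [mul_comm, hσφneg x hx, mul_comm]
    have h2 : ∀ α, σ x k α * φ x α = φ x α * σ x α k := by
      intro α
      rw [hσsym x hx k α, mul_comm]
    have h3 : ∑ α : Fin N, kd α α = (N : ℝ) := by
      simp [kd]
    have h4 : ∑ α : Fin N, ψ x α * kd α k = ψ x k := by
      simp [kd]
    simp only [h1, hS, h2, Finset.sum_add_distrib, Finset.sum_neg_distrib, ← Finset.mul_sum]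
    simp only [h3, h4]
    ring
  -- the middle term of the covariant derivative
  have hmid : (∑ α, GamS Γ' x α j n * GamT Γ x i α m)
      = (∑ α, GamS Γ x α j n * GamT Γ x i α m) - ψ x j * GamT Γ x i m n
        + ψ x n * GamT Γ x i j m + 2 * ((∑ α, GamT Γ x i α m * φ x α) * σ x j n) := by
    have h1 : ∑ α : Fin N, kd α n * GamT Γ x i α m = GamT Γ x i n m := by
      simp [kd]
    have h2 : ∑ α : Fin N, kd α j * GamT Γ x i α m = GamT Γ x i j m := by
      simp [kd]
    have h3 : ∀ α, GamS Γ' x α j n * GamT Γ x i α m = GamS Γ x α j n * GamT Γ x i α m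
        + ψ x j * (kd α n * GamT Γ x i α m) + ψ x n * (kd α j * GamT Γ x i α m)
        + 2 * σ x j n * (GamT Γ x i α m * φ x α) := by
      intro α
      rw [hS]
      ring
    simp only [h3, Finset.sum_add_distrib, ← Finset.mul_sum]
    rw [h1, h2, hTa]
    ring
  have hphi : (∑ α, GamT Γ x i α m * φ' x α) * σ' x j n
      = -((∑ α, GamT Γ x i α m * φ x α) * σ x j n) := by
    rw [Finset.sum_mul, Finset.sum_mul, ← Finset.sum_neg_distrib]
    refine Finset.sum_congr rfl fun α _ => ?_
    linear_combination GamT Γ x i α m * hσφneg x hx α j n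
  have hs : ∀ (G : (Fin N → ℝ) → Fin N → Fin N → Fin N → ℝ)
      (s : (Fin N → ℝ) → Fin N → Fin N → ℝ) (f : (Fin N → ℝ) → Fin N → ℝ),
      sigmaP G s f 3 x i j m n =
        (∑ α, GamS G x i α n * GamT G x α j m) - (∑ α, GamS G x α m n * GamT G x i j α)
        + (∑ α, GamT G x i α m * f x α) * s x j n
        - 1 / ((N : ℝ) + 1) *
          (GamT G x i j m * ((∑ α, GamS G x α n α) + ∑ α, f x α * s x α n)
          - GamT G x i m n * ((∑ α, GamS G x α j α) + ∑ α, f x α * s x α j)) := by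
    intro G s f
    have e : sigmaP G s f 3 x i j m n =
        (∑ α, GamT G x α j m * GamS G x i α n) - (∑ α, GamT G x i j α * GamS G x α m n)
        + (∑ α, GamT G x i α m * f x α) * s x j n
        - 1 / ((N : ℝ) + 1) *
          (GamT G x i j m * (∑ α, GamS G x α n α) - GamT G x i m n * (∑ α, GamS G x α j α)
          + GamT G x i j m * (∑ α, f x α * s x α n)
          - GamT G x i m n * (∑ α, f x α * s x α j)) := rfl
    rw [e]
    simp only [mul_comm (GamS G x _ _ _)]
    ring
  rw [hs, hs, htr, htr]
  unfold covTor
  rw [hp]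
  simp only [hT x hx]
  rw [hmid, hphi]
  field_simp
  ring
end
end

section
/- Under the stated hypotheses of an equitorsion third-type almost geodesic mapping with the property of reciprocity, at every point of U and for all indices i,j,m,n: Γ̄^i_[jm];̄n = Γ^i_[jm];n + σ̄_(5)^i_{jmn} − σ_(5)^i_{jmn} (the case p = 5 of the transformation rule for the covariant derivative of the torsion tensor), where ';' and ';̄' denote the covariant derivatives determined by the symmetric parts of Γ and Γ̄ respectively. -/
open scoped BigOperators

noncomputable section

/-- the case `p = 5` of the transformation rule for the covariant
derivative of the torsion tensor under an equitorsion third-type almost geodesic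
mapping with the property of reciprocity. -/
theorem stmt6 {N : ℕ} (hN : 2 ≤ N)
    (U : Set (Fin N → ℝ)) (hUopen : IsOpen U) (hUne : U.Nonempty)
    (Γ Γ' : (Fin N → ℝ) → Fin N → Fin N → Fin N → ℝ)
    (hΓ : ∀ i j k, ContDiffOn ℝ 2 (fun x => Γ x i j k) U)
    (hΓ' : ∀ i j k, ContDiffOn ℝ 2 (fun x => Γ' x i j k) U)
    (ψ φ : (Fin N → ℝ) → Fin N → ℝ) (σ : (Fin N → ℝ) → Fin N → Fin N → ℝ)
    (ψ' φ' : (Fin N → ℝ) → Fin N → ℝ) (σ' : (Fin N → ℝ) → Fin N → Fin N → ℝ)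
    (hψ : ∀ j, ContDiffOn ℝ 2 (fun x => ψ x j) U)
    (hφ : ∀ i, ContDiffOn ℝ 2 (fun x => φ x i) U)
    (hσ : ∀ j k, ContDiffOn ℝ 2 (fun x => σ x j k) U)
    (hσsym : ∀ x ∈ U, ∀ j k, σ x j k = σ x k j)
    (hψ' : ∀ j, ContDiffOn ℝ 2 (fun x => ψ' x j) U)
    (hφ' : ∀ i, ContDiffOn ℝ 2 (fun x => φ' x i) U)
    (hσ' : ∀ j k, ContDiffOn ℝ 2 (fun x => σ' x j k) U)
    (hσ'sym : ∀ x ∈ U, ∀ j k, σ' x j k = σ' x k j)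
    (hbasic : ∀ x ∈ U, ∀ i j k,
      Γ' x i j k = Γ x i j k + ψ x j * kd i k + ψ x k * kd i j + 2 * σ x j k * φ x i)
    (hrecip : ∀ x ∈ U, ∀ i j k,
      Γ x i j k = Γ' x i j k + ψ' x j * kd i k + ψ' x k * kd i j + 2 * σ' x j k * φ' x i)
    (hψneg : ∀ x ∈ U, ∀ j, ψ' x j = -ψ x j)
    (hσφneg : ∀ x ∈ U, ∀ i j k, σ' x j k * φ' x i = -(σ x j k * φ x i)) :
    ∀ x ∈ U, ∀ i j m n : Fin N,
      covTor Γ' x i j m n =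
        covTor Γ x i j m n + sigmaP Γ' σ' φ' 4 x i j m n - sigmaP Γ σ φ 4 x i j m n := by
  intro x hx i j m n
  have hT : ∀ y ∈ U, ∀ i j k, GamT Γ' y i j k = GamT Γ y i j k := by
    intro y hy i j k
    simp only [GamT, hbasic y hy, hσsym y hy k j]
    ring
  have hS : ∀ i j k, GamS Γ' x i j k =
      GamS Γ x i j k + (ψ x j * kd i k + ψ x k * kd i j + 2 * (σ x j k * φ x i)) := by
    intro i j k
    simp only [GamS, hbasic x hx, hσsym x hx k j]
    ring
  have hp : pder (fun y => GamT Γ' y i j m) n x = pder (fun y => GamT Γ y i j m) n x := by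
    unfold pder
    have : (fun y => GamT Γ' y i j m) =ᶠ[nhds x] (fun y => GamT Γ y i j m) := by
      filter_upwards [hUopen.mem_nhds hx] with y hy
      exact hT y hy i j m
    rw [this.fderiv_eq]
  have hkd : ∀ f : Fin N → ℝ, ∀ a : Fin N, ∑ α, f α * kd α a = f a := by
    intro f a
    simp [kd]
  have htr : ∀ a, ∑ β, GamS Γ' x β a β =
      ∑ β, GamS Γ x β a β + ((N : ℝ) + 1) * ψ x a + 2 * ∑ β, φ x β * σ x a β := by
    intro a
    have h1 : ∑ β : Fin N, ψ x a * kd β β = (N : ℝ) * ψ x a := by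
      simp [kd]
    simp only [hS, Finset.sum_add_distrib, h1, hkd, ← Finset.mul_sum]
    simp only [mul_comm (σ x a _)]
    ring
  have hσφ : ∀ a, ∑ β, φ' x β * σ' x a β = -∑ β, φ x β * σ x a β := by
    intro a
    rw [← Finset.sum_neg_distrib]
    refine Finset.sum_congr rfl fun β _ => ?_
    linarith [hσφneg x hx β a β]
  have h18 : (∑ α, GamT Γ x α j m * σ' x α n) * φ' x i =
      -((∑ α, GamT Γ x α j m * σ x α n) * φ x i) := by
    rw [Finset.sum_mul, Finset.sum_mul, ← Finset.sum_neg_distrib]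
    refine Finset.sum_congr rfl fun α _ => ?_
    linear_combination GamT Γ x α j m * hσφneg x hx i α n
  have h11 : ∑ α, φ x α * σ x α n = ∑ α, φ x α * σ x n α :=
    Finset.sum_congr rfl fun α _ => by rw [hσsym x hx]
  have h11' : ∑ α, φ' x α * σ' x α n = -∑ α, φ x α * σ x n α := by
    rw [← hσφ n]
    exact Finset.sum_congr rfl fun α _ => by rw [hσ'sym x hx]
  have h0 : ∑ α, GamS Γ' x i α n * GamT Γ x α j m =
      ∑ α, GamS Γ x i α n * GamT Γ x α j m + kd i n * ∑ α, GamT Γ x α j m * ψ x α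
      + ψ x n * GamT Γ x i j m + 2 * ((∑ α, GamT Γ x α j m * σ x α n) * φ x i) := by
    have e : ψ x n * GamT Γ x i j m = ∑ α, ψ x n * GamT Γ x α j m * kd α i := by
      rw [hkd (fun α => ψ x n * GamT Γ x α j m)]
    rw [e, Finset.sum_mul, Finset.mul_sum, Finset.mul_sum, ← Finset.sum_add_distrib,
      ← Finset.sum_add_distrib, ← Finset.sum_add_distrib]
    refine Finset.sum_congr rfl fun α _ => ?_
    have : kd i α = kd α i := by simp [kd, eq_comm]
    rw [hS, this]
    ring
  have h14 : ∑ α, GamT Γ x α j m * ∑ β, GamS Γ' x β α β =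
      ∑ α, GamT Γ x α j m * ∑ β, GamS Γ x β α β
      + ((N : ℝ) + 1) * ∑ α, GamT Γ x α j m * ψ x α
      + 2 * ∑ α, GamT Γ x α j m * ∑ β, φ x β * σ x α β := by
    rw [Finset.mul_sum, Finset.mul_sum, ← Finset.sum_add_distrib, ← Finset.sum_add_distrib]
    refine Finset.sum_congr rfl fun α _ => ?_
    rw [htr]
    ring
  have h16 : ∑ α, GamT Γ x α j m * ∑ β, φ' x β * σ' x α β =
      -∑ α, GamT Γ x α j m * ∑ β, φ x β * σ x α β := by
    rw [← Finset.sum_neg_distrib]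
    refine Finset.sum_congr rfl fun α _ => ?_
    rw [hσφ]
    ring
  have hc : (1 / ((N : ℝ) + 1)) * ((N : ℝ) + 1) = 1 := by
    have : (N : ℝ) + 1 ≠ 0 := by positivity
    field_simp
  have key : ∀ (G : (Fin N → ℝ) → Fin N → Fin N → Fin N → ℝ)
      (s : (Fin N → ℝ) → Fin N → Fin N → ℝ) (f : (Fin N → ℝ) → Fin N → ℝ),
      sigmaP G s f 4 x i j m n =
        -((∑ α, GamT G x α j m * s x α n) * f x i)
        - (∑ α, GamS G x α j n * GamT G x i α m) - (∑ α, GamS G x α m n * GamT G x i j α)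
        + (1 / ((N : ℝ) + 1)) * ((kd i n * ∑ α, GamT G x α j m * ∑ β, GamS G x β α β)
          + (GamT G x i j m * ∑ α, GamS G x α n α)
          + (kd i n * ∑ α, GamT G x α j m * ∑ β, f x β * s x α β)
          + (GamT G x i j m * ∑ α, f x α * s x α n)) := by
    intro G s f
    simp only [mul_comm (GamS G x _ _ _) (GamT G x _ _ _)]
    rfl
  rw [key, key]
  unfold covTor
  rw [hp]
  simp only [hT x hx]
  rw [h0, h18, h14, h16, h11, h11', htr n]
  linear_combination
    (-(kd i n * ∑ α, GamT Γ x α j m * ψ x α) - ψ x n * GamT Γ x i j m) * hc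
end
end

section
/- Under the stated hypotheses of an equitorsion third-type almost geodesic mapping with the property of reciprocity, at every point of U and for all indices i,j,m,n: Γ̄^i_[jm];̄n = Γ^i_[jm];n + σ̄_(6)^i_{jmn} − σ_(6)^i_{jmn} (the case p = 6 of the transformation rule for the covariant derivative of the torsion tensor), where ';' and ';̄' denote the covariant derivatives determined by the symmetric parts of Γ and Γ̄ respectively. -/
open scoped BigOperators

noncomputable section

/-- the case `p = 6` of the transformation rule for the covariant
derivative of the torsion tensor under an equitorsion third-type almost geodesic
mapping with the property of reciprocity. -/
theorem stmt7 {N : ℕ} (hN : 2 ≤ N)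
    (U : Set (Fin N → ℝ)) (hUopen : IsOpen U) (hUne : U.Nonempty)
    (Γ Γ' : (Fin N → ℝ) → Fin N → Fin N → Fin N → ℝ)
    (hΓ : ∀ i j k, ContDiffOn ℝ 2 (fun x => Γ x i j k) U)
    (hΓ' : ∀ i j k, ContDiffOn ℝ 2 (fun x => Γ' x i j k) U)
    (ψ φ : (Fin N → ℝ) → Fin N → ℝ) (σ : (Fin N → ℝ) → Fin N → Fin N → ℝ)
    (ψ' φ' : (Fin N → ℝ) → Fin N → ℝ) (σ' : (Fin N → ℝ) → Fin N → Fin N → ℝ)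
    (hψ : ∀ j, ContDiffOn ℝ 2 (fun x => ψ x j) U)
    (hφ : ∀ i, ContDiffOn ℝ 2 (fun x => φ x i) U)
    (hσ : ∀ j k, ContDiffOn ℝ 2 (fun x => σ x j k) U)
    (hσsym : ∀ x ∈ U, ∀ j k, σ x j k = σ x k j)
    (hψ' : ∀ j, ContDiffOn ℝ 2 (fun x => ψ' x j) U)
    (hφ' : ∀ i, ContDiffOn ℝ 2 (fun x => φ' x i) U)
    (hσ' : ∀ j k, ContDiffOn ℝ 2 (fun x => σ' x j k) U)
    (hσ'sym : ∀ x ∈ U, ∀ j k, σ' x j k = σ' x k j)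
    (hbasic : ∀ x ∈ U, ∀ i j k,
      Γ' x i j k = Γ x i j k + ψ x j * kd i k + ψ x k * kd i j + 2 * σ x j k * φ x i)
    (hrecip : ∀ x ∈ U, ∀ i j k,
      Γ x i j k = Γ' x i j k + ψ' x j * kd i k + ψ' x k * kd i j + 2 * σ' x j k * φ' x i)
    (hψneg : ∀ x ∈ U, ∀ j, ψ' x j = -ψ x j)
    (hσφneg : ∀ x ∈ U, ∀ i j k, σ' x j k * φ' x i = -(σ x j k * φ x i)) :
    ∀ x ∈ U, ∀ i j m n : Fin N,
      covTor Γ' x i j m n =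
        covTor Γ x i j m n + sigmaP Γ' σ' φ' 5 x i j m n - sigmaP Γ σ φ 5 x i j m n := by
  intro x hx i j m n
  have hTU : ∀ y ∈ U, ∀ i j k, GamT Γ' y i j k = GamT Γ y i j k := by
    intro y hy i j k
    simp only [GamT]
    rw [hbasic y hy i j k, hbasic y hy i k j, hσsym y hy k j]
    ring
  have hT := hTU x hx
  have hp : pder (fun y => GamT Γ' y i j m) n x = pder (fun y => GamT Γ y i j m) n x := by
    unfold pder
    rw [Filter.EventuallyEq.fderiv_eq]
    filter_upwards [hUopen.mem_nhds hx] with y hy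
    exact hTU y hy i j m
  have hS : ∀ i j k, GamS Γ' x i j k
      = GamS Γ x i j k + ψ x j * kd i k + ψ x k * kd i j + 2 * (σ x j k * φ x i) := by
    intro i j k
    simp only [GamS]
    rw [hbasic x hx i j k, hbasic x hx i k j, hσsym x hx k j]
    ring
  have hanti : ∀ i j k, GamT Γ x i j k = - GamT Γ x i k j := by
    intro i j k
    simp only [GamT]
    ring
  -- trace of the connection difference
  have htr : ∀ k, ∑ α, GamS Γ' x α k α
      = (∑ α, GamS Γ x α k α) + ((N : ℝ) + 1) * ψ x k + 2 * ∑ α, φ x α * σ x α k := by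
    intro k
    simp only [hS, Finset.sum_add_distrib, Finset.mul_sum]
    have h1 : ∑ α : Fin N, ψ x k * kd α α = (N : ℝ) * ψ x k := by simp [kd]
    have h2 : ∑ α : Fin N, ψ x α * kd α k = ψ x k := by simp [kd]
    have h3 : ∑ α, 2 * (σ x k α * φ x α) = ∑ α, 2 * (φ x α * σ x α k) := by
      refine Finset.sum_congr rfl fun α _ => ?_
      rw [hσsym x hx k α]; ring
    rw [h1, h2, h3]; ring
  have hφσ : ∀ k, ∑ α, φ' x α * σ' x α k = - ∑ α, φ x α * σ x α k := by
    intro k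
    rw [← Finset.sum_neg_distrib]
    refine Finset.sum_congr rfl fun α _ => ?_
    have := hσφneg x hx α α k
    linarith
  have hφσ2 : ∀ k, ∑ α, φ' x α * σ' x k α = - ∑ α, φ x α * σ x α k := by
    intro k
    rw [← hφσ]
    exact Finset.sum_congr rfl fun α _ => by rw [hσ'sym x hx k α]
  have hφσ3 : ∀ k, ∑ α, φ x α * σ x k α = ∑ α, φ x α * σ x α k := by
    intro k
    exact Finset.sum_congr rfl fun α _ => by rw [hσsym x hx k α]
  have e18 : (∑ α, GamT Γ x α j m * σ' x α n) * φ' x i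
      = -((∑ α, GamT Γ x α j m * σ x α n) * φ x i) := by
    rw [Finset.sum_mul, Finset.sum_mul, ← Finset.sum_neg_distrib]
    refine Finset.sum_congr rfl fun α _ => ?_
    linear_combination GamT Γ x α j m * hσφneg x hx i α n
  have eV : ∀ (t : Fin N → ℝ) (a b : Fin N), (∑ α, t α * φ' x α) * σ' x a b
      = -((∑ α, t α * φ x α) * σ x a b) := by
    intro t a b
    rw [Finset.sum_mul, Finset.sum_mul, ← Finset.sum_neg_distrib]
    refine Finset.sum_congr rfl fun α _ => ?_
    linear_combination t α * hσφneg x hx α a b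
  -- the three contractions of the covariant derivative
  have c1 : ∑ α, GamS Γ' x i α n * GamT Γ x α j m
      = (∑ α, GamS Γ x i α n * GamT Γ x α j m) + kd i n * (∑ α, GamT Γ x α j m * ψ x α)
        + ψ x n * GamT Γ x i j m + 2 * ((∑ α, GamT Γ x α j m * σ x α n) * φ x i) := by
    have h : ψ x n * GamT Γ x i j m = ∑ α, ψ x n * kd i α * GamT Γ x α j m := by simp [kd]
    rw [h, Finset.sum_mul, Finset.mul_sum, Finset.mul_sum, ← Finset.sum_add_distrib,
      ← Finset.sum_add_distrib, ← Finset.sum_add_distrib]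
    refine Finset.sum_congr rfl fun α _ => ?_
    rw [hS]; ring
  have c2 : ∀ (t : Fin N → ℝ) (a b : Fin N), ∑ α, GamS Γ' x α a b * t α
      = (∑ α, GamS Γ x α a b * t α) + ψ x a * t b + ψ x b * t a
        + 2 * ((∑ α, t α * φ x α) * σ x a b) := by
    intro t a b
    have h : ψ x a * t b = ∑ α, ψ x a * kd α b * t α := by simp [kd]
    have h' : ψ x b * t a = ∑ α, ψ x b * kd α a * t α := by simp [kd]
    rw [h, h', Finset.sum_mul, Finset.mul_sum, ← Finset.sum_add_distrib,
      ← Finset.sum_add_distrib, ← Finset.sum_add_distrib]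
    refine Finset.sum_congr rfl fun α _ => ?_
    rw [hS]; ring
  have e14 : ∑ α, GamT Γ x α j m * ∑ β, GamS Γ' x β α β
      = (∑ α, GamT Γ x α j m * ∑ β, GamS Γ x β α β)
        + ((N : ℝ) + 1) * (∑ α, GamT Γ x α j m * ψ x α)
        + 2 * ∑ α, GamT Γ x α j m * ∑ β, φ x β * σ x β α := by
    rw [Finset.mul_sum, Finset.mul_sum, ← Finset.sum_add_distrib, ← Finset.sum_add_distrib]
    refine Finset.sum_congr rfl fun α _ => ?_
    rw [htr]; ring
  have e16 : ∑ α, GamT Γ x α j m * ∑ β, φ' x β * σ' x α β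
      = -∑ α, GamT Γ x α j m * ∑ β, φ x β * σ x β α := by
    rw [← Finset.sum_neg_distrib]
    refine Finset.sum_congr rfl fun α _ => ?_
    rw [hφσ2]; ring
  have e16' : ∑ α, GamT Γ x α j m * ∑ β, φ x β * σ x α β
      = ∑ α, GamT Γ x α j m * ∑ β, φ x β * σ x β α := by
    refine Finset.sum_congr rfl fun α _ => ?_
    rw [hφσ3]
  have s6 : ∀ (G : (Fin N → ℝ) → Fin N → Fin N → Fin N → ℝ)
      (s : (Fin N → ℝ) → Fin N → Fin N → ℝ) (f : (Fin N → ℝ) → Fin N → ℝ),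
      sigmaP G s f 5 x i j m n =
        -((∑ α, GamT G x α j m * s x α n) * f x i)
        + (∑ α, GamT G x i α m * f x α) * s x j n
        + (∑ α, GamT G x i j α * f x α) * s x m n
        + 1 / ((N : ℝ) + 1) * (kd i n * (∑ α, GamT G x α j m * ∑ β, GamS G x β α β)
          - GamT G x i j m * (∑ α, GamS G x α n α) - GamT G x i j n * (∑ α, GamS G x α m α)
          + GamT G x i m n * (∑ α, GamS G x α j α))
        + 1 / ((N : ℝ) + 1) * (kd i n * (∑ α, GamT G x α j m * ∑ β, f x β * s x α β)
          - GamT G x i j m * (∑ α, f x α * s x α n) - GamT G x i j n * (∑ α, f x α * s x α m)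
          + GamT G x i m n * (∑ α, f x α * s x α j)) := fun G s f => rfl
  rw [s6, s6]
  simp only [covTor]
  rw [hp]
  simp only [hT]
  rw [c1, c2 (fun α => GamT Γ x i α m), c2 (fun α => GamT Γ x i j α), e18,
    eV (fun α => GamT Γ x i α m), eV (fun α => GamT Γ x i j α), e14, e16, e16',
    htr, htr, htr, hφσ, hφσ, hφσ, hanti i n m]
  have hN1 : (N : ℝ) + 1 ≠ 0 := by positivity
  field_simp
  ring
end
end

section
/- Under the stated hypotheses of an equitorsion third-type almost geodesic mapping with the property of reciprocity, at every point of U and for all indices i,j,m,n: Γ̄^i_[jm];̄n = Γ^i_[jm];n + σ̄_(7)^i_{jmn} − σ_(7)^i_{jmn} (the case p = 7 of the transformation rule for the covariant derivative of the torsion tensor), where ';' and ';̄' denote the covariant derivatives determined by the symmetric parts of Γ and Γ̄ respectively. -/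
open scoped BigOperators

noncomputable section

/-- the case `p = 7` of the transformation rule for the covariant
derivative of the torsion tensor under an equitorsion third-type almost geodesic
mapping with the property of reciprocity. -/
theorem stmt8 {N : ℕ} (hN : 2 ≤ N)
    (U : Set (Fin N → ℝ)) (hUopen : IsOpen U) (hUne : U.Nonempty)
    (Γ Γ' : (Fin N → ℝ) → Fin N → Fin N → Fin N → ℝ)
    (hΓ : ∀ i j k, ContDiffOn ℝ 2 (fun x => Γ x i j k) U)
    (hΓ' : ∀ i j k, ContDiffOn ℝ 2 (fun x => Γ' x i j k) U)
    (ψ φ : (Fin N → ℝ) → Fin N → ℝ) (σ : (Fin N → ℝ) → Fin N → Fin N → ℝ)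
    (ψ' φ' : (Fin N → ℝ) → Fin N → ℝ) (σ' : (Fin N → ℝ) → Fin N → Fin N → ℝ)
    (hψ : ∀ j, ContDiffOn ℝ 2 (fun x => ψ x j) U)
    (hφ : ∀ i, ContDiffOn ℝ 2 (fun x => φ x i) U)
    (hσ : ∀ j k, ContDiffOn ℝ 2 (fun x => σ x j k) U)
    (hσsym : ∀ x ∈ U, ∀ j k, σ x j k = σ x k j)
    (hψ' : ∀ j, ContDiffOn ℝ 2 (fun x => ψ' x j) U)
    (hφ' : ∀ i, ContDiffOn ℝ 2 (fun x => φ' x i) U)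
    (hσ' : ∀ j k, ContDiffOn ℝ 2 (fun x => σ' x j k) U)
    (hσ'sym : ∀ x ∈ U, ∀ j k, σ' x j k = σ' x k j)
    (hbasic : ∀ x ∈ U, ∀ i j k,
      Γ' x i j k = Γ x i j k + ψ x j * kd i k + ψ x k * kd i j + 2 * σ x j k * φ x i)
    (hrecip : ∀ x ∈ U, ∀ i j k,
      Γ x i j k = Γ' x i j k + ψ' x j * kd i k + ψ' x k * kd i j + 2 * σ' x j k * φ' x i)
    (hψneg : ∀ x ∈ U, ∀ j, ψ' x j = -ψ x j)
    (hσφneg : ∀ x ∈ U, ∀ i j k, σ' x j k * φ' x i = -(σ x j k * φ x i)) :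
    ∀ x ∈ U, ∀ i j m n : Fin N,
      covTor Γ' x i j m n =
        covTor Γ x i j m n + sigmaP Γ' σ' φ' 6 x i j m n - sigmaP Γ σ φ 6 x i j m n := by
  intro x hx i j m n
  have hT : ∀ y ∈ U, ∀ a b c, GamT Γ' y a b c = GamT Γ y a b c := by
    intro y hy a b c
    simp only [GamT]
    rw [hbasic y hy a b c, hbasic y hy a c b, hσsym y hy c b]
    ring
  have hS : ∀ a b c, GamS Γ' x a b c
      = GamS Γ x a b c + ψ x b * kd a c + ψ x c * kd a b + 2 * (σ x b c * φ x a) := by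
    intro a b c
    simp only [GamS]
    rw [hbasic x hx a b c, hbasic x hx a c b, hσsym x hx c b]
    ring
  have hTx := hT x hx
  have hP : pder (fun y => GamT Γ' y i j m) n x = pder (fun y => GamT Γ y i j m) n x := by
    unfold pder
    have : (fun y => GamT Γ' y i j m) =ᶠ[nhds x] (fun y => GamT Γ y i j m) := by
      filter_upwards [hUopen.mem_nhds hx] with y hy using hT y hy i j m
    rw [this.fderiv_eq]
  have hneg := hσφneg x hx
  have hN1 : (N : ℝ) + 1 ≠ 0 := by positivity
  -- trace identity
  have htr : ∀ a, (∑ β, GamS Γ' x β a β) + ∑ β, φ' x β * σ' x a β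
      = (∑ β, GamS Γ x β a β) + (∑ β, φ x β * σ x a β) + ((N : ℝ) + 1) * ψ x a := by
    intro a
    have h1 : ∑ β, φ' x β * σ' x a β = - ∑ β, φ x β * σ x a β := by
      rw [← Finset.sum_neg_distrib]
      refine Finset.sum_congr rfl fun β _ => ?_
      linarith [hneg β a β]
    have h2 : ∑ β, GamS Γ' x β a β = (∑ β, GamS Γ x β a β) + ((N : ℝ) + 1) * ψ x a
        + 2 * ∑ β, φ x β * σ x a β := by
      simp only [hS, Finset.sum_add_distrib, kd, Finset.mul_sum]
      simp [mul_comm, mul_left_comm]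
      ring
    rw [h1, h2]; ring
  have h0 : ∑ α, GamS Γ' x i α n * GamT Γ x α j m = (∑ α, GamS Γ x i α n * GamT Γ x α j m)
      + kd i n * (∑ α, GamT Γ x α j m * ψ x α) + ψ x n * GamT Γ x i j m
      + 2 * ((∑ α, GamT Γ x α j m * σ x α n) * φ x i) := by
    have e : ψ x n * GamT Γ x i j m = ∑ α, ψ x n * (kd i α * GamT Γ x α j m) := by
      simp [kd]
    rw [e, Finset.sum_mul, Finset.mul_sum, Finset.mul_sum, ← Finset.sum_add_distrib,
      ← Finset.sum_add_distrib, ← Finset.sum_add_distrib]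
    refine Finset.sum_congr rfl fun α _ => ?_
    rw [hS]; ring
  have h4 : ∑ α, GamS Γ' x α m n * GamT Γ x i j α = (∑ α, GamS Γ x α m n * GamT Γ x i j α)
      + ψ x m * GamT Γ x i j n + ψ x n * GamT Γ x i j m
      + 2 * ((∑ α, GamT Γ x i j α * φ x α) * σ x m n) := by
    have e : ψ x n * GamT Γ x i j m = ∑ α, ψ x n * (kd α m * GamT Γ x i j α) := by
      simp [kd]
    have e' : ψ x m * GamT Γ x i j n = ∑ α, ψ x m * (kd α n * GamT Γ x i j α) := by
      simp [kd]
    rw [e, e', Finset.sum_mul, Finset.mul_sum, ← Finset.sum_add_distrib,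
      ← Finset.sum_add_distrib, ← Finset.sum_add_distrib]
    refine Finset.sum_congr rfl fun α _ => ?_
    rw [hS]; ring
  have h18 : (∑ α, GamT Γ x α j m * σ' x α n) * φ' x i
      = -((∑ α, GamT Γ x α j m * σ x α n) * φ x i) := by
    rw [Finset.sum_mul, Finset.sum_mul, ← Finset.sum_neg_distrib]
    refine Finset.sum_congr rfl fun α _ => ?_
    linear_combination GamT Γ x α j m * hneg i α n
  have h10 : (∑ α, GamT Γ x i j α * φ' x α) * σ' x m n
      = -((∑ α, GamT Γ x i j α * φ x α) * σ x m n) := by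
    rw [Finset.sum_mul, Finset.sum_mul, ← Finset.sum_neg_distrib]
    refine Finset.sum_congr rfl fun α _ => ?_
    linear_combination GamT Γ x i j α * hneg α m n
  have h1416 : (∑ α, GamT Γ x α j m * ∑ β, GamS Γ' x β α β)
      + (∑ α, GamT Γ x α j m * ∑ β, φ' x β * σ' x α β)
      = (∑ α, GamT Γ x α j m * ∑ β, GamS Γ x β α β)
      + (∑ α, GamT Γ x α j m * ∑ β, φ x β * σ x α β)
      + ((N : ℝ) + 1) * ∑ α, GamT Γ x α j m * ψ x α := by
    rw [Finset.mul_sum, ← Finset.sum_add_distrib, ← Finset.sum_add_distrib,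
      ← Finset.sum_add_distrib]
    refine Finset.sum_congr rfl fun α _ => ?_
    linear_combination GamT Γ x α j m * htr α
  have hm := htr m
  have s1 : ∑ β, φ x β * σ x m β = ∑ β, φ x β * σ x β m :=
    Finset.sum_congr rfl fun β _ => by rw [hσsym x hx m β]
  have s2 : ∑ β, φ' x β * σ' x m β = ∑ β, φ' x β * σ' x β m :=
    Finset.sum_congr rfl fun β _ => by rw [hσ'sym x hx m β]
  rw [s1, s2] at hm
  have c2 : ∀ G : (Fin N → ℝ) → Fin N → Fin N → Fin N → ℝ,
      ∑ α, GamT Γ x i α m * GamS G x α j n = ∑ α, GamS G x α j n * GamT Γ x i α m :=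
    fun G => Finset.sum_congr rfl fun α _ => mul_comm _ _
  have key : ∀ (G : (Fin N → ℝ) → Fin N → Fin N → Fin N → ℝ) s f,
      sigmaP G s f 6 x i j m n =
      -((∑ α, GamT G x α j m * s x α n) * f x i) - (∑ α, GamT G x i α m * GamS G x α j n)
      + ((∑ α, GamT G x i j α * f x α) * s x m n)
      + 1 / ((N : ℝ) + 1) * ((kd i n * ∑ α, GamT G x α j m * ∑ β, GamS G x β α β)
        - (GamT G x i j n * ∑ α, GamS G x α m α)
        + (kd i n * ∑ α, GamT G x α j m * ∑ β, f x β * s x α β)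
        - (GamT G x i j n * ∑ α, f x α * s x α m)) := fun _ _ _ => rfl
  rw [key, key]
  unfold covTor
  rw [hP]
  simp only [hTx, c2]
  rw [h0, h4, h18, h10]
  have hc : 1 / ((N : ℝ) + 1) * ((N : ℝ) + 1) = 1 := by field_simp
  generalize 1 / ((N : ℝ) + 1) = c at hc ⊢
  linear_combination (-c * kd i n) * h1416 + c * GamT Γ x i j n * hm
    + (GamT Γ x i j n * ψ x m - kd i n * ∑ α, GamT Γ x α j m * ψ x α) * hc
end
end

section
/- Under the stated hypotheses of an equitorsion third-type almost geodesic mapping with the property of reciprocity, at every point of U and for all indices i,j,m,n: Γ̄^i_[jm];̄n = Γ^i_[jm];n + σ̄_(8)^i_{jmn} − σ_(8)^i_{jmn} (the case p = 8 of the transformation rule for the covariant derivative of the torsion tensor), where ';' and ';̄' denote the covariant derivatives determined by the symmetric parts of Γ and Γ̄ respectively. -/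
open scoped BigOperators

noncomputable section

/-- the case `p = 8` of the transformation rule for the covariant
derivative of the torsion tensor under an equitorsion third-type almost geodesic
mapping with the property of reciprocity. -/
theorem stmt9 {N : ℕ} (hN : 2 ≤ N)
    (U : Set (Fin N → ℝ)) (hUopen : IsOpen U) (hUne : U.Nonempty)
    (Γ Γ' : (Fin N → ℝ) → Fin N → Fin N → Fin N → ℝ)
    (hΓ : ∀ i j k, ContDiffOn ℝ 2 (fun x => Γ x i j k) U)
    (hΓ' : ∀ i j k, ContDiffOn ℝ 2 (fun x => Γ' x i j k) U)
    (ψ φ : (Fin N → ℝ) → Fin N → ℝ) (σ : (Fin N → ℝ) → Fin N → Fin N → ℝ)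
    (ψ' φ' : (Fin N → ℝ) → Fin N → ℝ) (σ' : (Fin N → ℝ) → Fin N → Fin N → ℝ)
    (hψ : ∀ j, ContDiffOn ℝ 2 (fun x => ψ x j) U)
    (hφ : ∀ i, ContDiffOn ℝ 2 (fun x => φ x i) U)
    (hσ : ∀ j k, ContDiffOn ℝ 2 (fun x => σ x j k) U)
    (hσsym : ∀ x ∈ U, ∀ j k, σ x j k = σ x k j)
    (hψ' : ∀ j, ContDiffOn ℝ 2 (fun x => ψ' x j) U)
    (hφ' : ∀ i, ContDiffOn ℝ 2 (fun x => φ' x i) U)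
    (hσ' : ∀ j k, ContDiffOn ℝ 2 (fun x => σ' x j k) U)
    (hσ'sym : ∀ x ∈ U, ∀ j k, σ' x j k = σ' x k j)
    (hbasic : ∀ x ∈ U, ∀ i j k,
      Γ' x i j k = Γ x i j k + ψ x j * kd i k + ψ x k * kd i j + 2 * σ x j k * φ x i)
    (hrecip : ∀ x ∈ U, ∀ i j k,
      Γ x i j k = Γ' x i j k + ψ' x j * kd i k + ψ' x k * kd i j + 2 * σ' x j k * φ' x i)
    (hψneg : ∀ x ∈ U, ∀ j, ψ' x j = -ψ x j)
    (hσφneg : ∀ x ∈ U, ∀ i j k, σ' x j k * φ' x i = -(σ x j k * φ x i)) :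
    ∀ x ∈ U, ∀ i j m n : Fin N,
      covTor Γ' x i j m n =
        covTor Γ x i j m n + sigmaP Γ' σ' φ' 7 x i j m n - sigmaP Γ σ φ 7 x i j m n := by
  intro x hx i j m n
  have hTU : ∀ y ∈ U, ∀ a b c, GamT Γ' y a b c = GamT Γ y a b c := by
    intro y hy a b c
    simp only [GamT, hbasic y hy, hσsym y hy c b]
    ring
  have hT := hTU x hx
  have hS : ∀ a b c, GamS Γ' x a b c =
      GamS Γ x a b c + ψ x b * kd a c + ψ x c * kd a b + 2 * (σ x b c * φ x a) := by
    intro a b c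
    simp only [GamS, hbasic x hx, hσsym x hx c b]
    ring
  have hTanti : ∀ a b c, GamT Γ x a b c = - GamT Γ x a c b := by
    intro a b c
    simp only [GamT]
    ring
  have hd : pder (fun y => GamT Γ' y i j m) n x = pder (fun y => GamT Γ y i j m) n x := by
    unfold pder
    have h : (fun y => GamT Γ' y i j m) =ᶠ[nhds x] (fun y => GamT Γ y i j m) := by
      filter_upwards [hUopen.mem_nhds hx] with y hy
      exact hTU y hy i j m
    rw [h.fderiv_eq]
  have hP : ∀ b, ∑ α, φ' x α * σ' x α b = -∑ α, φ x α * σ x α b := by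
    intro b
    rw [← Finset.sum_neg_distrib]
    refine Finset.sum_congr rfl fun α _ => ?_
    linarith [hσφneg x hx α α b]
  have hP2 : ∀ b, ∑ α, φ x α * σ x b α = ∑ α, φ x α * σ x α b := fun b =>
    Finset.sum_congr rfl fun α _ => by rw [hσsym x hx]
  have hP2' : ∀ b, ∑ α, φ' x α * σ' x b α = ∑ α, φ' x α * σ' x α b := fun b =>
    Finset.sum_congr rfl fun α _ => by rw [hσ'sym x hx]
  have htr : ∀ b, ∑ α, GamS Γ' x α b α =
      ∑ α, GamS Γ x α b α + ((N : ℝ) + 1) * ψ x b + 2 * ∑ α, φ x α * σ x α b := by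
    intro b
    have e : ∀ α, GamS Γ' x α b α =
        GamS Γ x α b α + ψ x b + ψ x α * kd α b + 2 * (φ x α * σ x α b) := by
      intro α
      rw [hS, hσsym x hx b α]
      simp only [kd, if_true]
      ring
    simp only [e, Finset.sum_add_distrib, ← Finset.mul_sum]
    simp [kd]
    ring
  have h8 : (∑ α, GamT Γ x i α m * φ' x α) * σ' x j n
      = -((∑ α, GamT Γ x i α m * φ x α) * σ x j n) := by
    rw [Finset.sum_mul, Finset.sum_mul, ← Finset.sum_neg_distrib]
    refine Finset.sum_congr rfl fun α _ => ?_
    linear_combination GamT Γ x i α m * hσφneg x hx α j n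
  have h18 : (∑ α, GamT Γ x α j m * σ' x α n) * φ' x i
      = -((∑ α, GamT Γ x α j m * σ x α n) * φ x i) := by
    rw [Finset.sum_mul, Finset.sum_mul, ← Finset.sum_neg_distrib]
    refine Finset.sum_congr rfl fun α _ => ?_
    linear_combination GamT Γ x α j m * hσφneg x hx i α n
  have hA : ∑ α, GamS Γ' x i α n * GamT Γ x α j m =
      ∑ α, GamS Γ x i α n * GamT Γ x α j m + kd i n * (∑ α, GamT Γ x α j m * ψ x α)
      + ψ x n * GamT Γ x i j m + 2 * ((∑ α, GamT Γ x α j m * σ x α n) * φ x i) := by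
    have e : ∀ α, GamS Γ' x i α n * GamT Γ x α j m =
        GamS Γ x i α n * GamT Γ x α j m + kd i n * (GamT Γ x α j m * ψ x α)
        + ψ x n * (kd i α * GamT Γ x α j m) + 2 * (GamT Γ x α j m * σ x α n * φ x i) := by
      intro α
      rw [hS]
      ring
    simp only [e, Finset.sum_add_distrib, ← Finset.mul_sum, ← Finset.sum_mul]
    simp [kd]
  have hB : ∑ α, GamS Γ' x α j n * GamT Γ x i α m =
      ∑ α, GamS Γ x α j n * GamT Γ x i α m + ψ x j * GamT Γ x i n m
      + ψ x n * GamT Γ x i j m + 2 * ((∑ α, GamT Γ x i α m * φ x α) * σ x j n) := by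
    have e : ∀ α, GamS Γ' x α j n * GamT Γ x i α m =
        GamS Γ x α j n * GamT Γ x i α m + ψ x j * (kd α n * GamT Γ x i α m)
        + ψ x n * (kd α j * GamT Γ x i α m) + 2 * (GamT Γ x i α m * φ x α * σ x j n) := by
      intro α
      rw [hS]
      ring
    simp only [e, Finset.sum_add_distrib, ← Finset.mul_sum, ← Finset.sum_mul]
    simp [kd]
  have h4 : ∀ G : (Fin N → ℝ) → Fin N → Fin N → Fin N → ℝ,
      ∑ α, GamT Γ x i j α * GamS G x α m n = ∑ α, GamS G x α m n * GamT Γ x i j α := fun G =>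
    Finset.sum_congr rfl fun α _ => mul_comm _ _
  have h14 : ∑ α, GamT Γ x α j m * ∑ β, GamS Γ' x β α β =
      ∑ α, GamT Γ x α j m * ∑ β, GamS Γ x β α β
      + ((N : ℝ) + 1) * (∑ α, GamT Γ x α j m * ψ x α)
      + 2 * ∑ α, GamT Γ x α j m * ∑ β, φ x β * σ x β α := by
    rw [Finset.mul_sum, Finset.mul_sum, ← Finset.sum_add_distrib, ← Finset.sum_add_distrib]
    refine Finset.sum_congr rfl fun α _ => ?_
    rw [htr]
    ring
  have hs : ∀ (G : (Fin N → ℝ) → Fin N → Fin N → Fin N → ℝ)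
      (s : (Fin N → ℝ) → Fin N → Fin N → ℝ) (f : (Fin N → ℝ) → Fin N → ℝ),
      sigmaP G s f 7 x i j m n =
      -((∑ α, GamT G x α j m * s x α n) * f x i) - (∑ α, GamT G x i j α * GamS G x α m n)
      + ((∑ α, GamT G x i α m * f x α) * s x j n)
      + 1 / ((N : ℝ) + 1) * ((kd i n * ∑ α, GamT G x α j m * ∑ β, GamS G x β α β)
        + (GamT G x i m n * ∑ α, GamS G x α j α)
        + (kd i n * ∑ α, GamT G x α j m * ∑ β, f x β * s x α β)
        + (GamT G x i m n * ∑ α, f x α * s x α j)) := fun G s f => rfl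
  have hN1 : (N : ℝ) + 1 ≠ 0 := by positivity
  rw [hs, hs]
  unfold covTor
  rw [hd]
  simp only [hT, h14]
  simp only [hP2, hP2', hP, h8, h18, hA, hB, h4, htr, mul_neg, Finset.sum_neg_distrib]
  rw [hTanti i n m]
  field_simp
  ring
end
end

section
/- Fix an integer N ≥ 2 and set c = 1/(N+1). Let M be the 8×20 real matrix whose p-th row (p = 1,…,8) is the coefficient vector of σ_(p) with respect to the ordered basis U1,…,U20, namely: row 1 = (1,0,−1,0,−1,0,…,0); row 2 has entry 1 at position 1, entries 1 at positions 9 and 11, entries −2c, −c, c at positions 6, 7, 8 and −2c, −c, c at positions 12, 13, 14; row 3 has entry 1 at position 1, −1 at position 3, 1 at position 11, and −c at positions 6, 7, 12, 13; row 4 has entry 1 at position 1, −1 at position 5, 1 at position 9, and −c, c, −c, c at positions 6, 8, 12, 14; row 5 has −1 at positions 19, 3, 5 and c at positions 15, 6, 17, 12; row 6 has −1 at position 19, 1 at positions 9 and 11, entries c, −c, −c, c at positions 15, 6, 7, 8 and c, −c, −c, c at positions 17, 12, 13, 14; row 7 has −1 at positions 19 and 3, 1 at position 11, c at positions 15 and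 17, and −c at positions 7 and 13; row 8 has −1 at positions 19 and 5, 1 at position 9, and c at positions 15, 8, 17, 14. Then the rank of M is 4; that is, exactly four of the eight transformation rules of the covariant derivative of the torsion tensor under equitorsion third-type almost geodesic mappings are linearly independent. -/
noncomputable section

/-- The 8×20 coefficient matrix of the deformation objects `σ_(1), …, σ_(8)` with respect to
the ordered basis `U1, …, U20`, with `c = 1/(N+1)`. -/
def Mmat (N : ℕ) : Matrix (Fin 8) (Fin 20) ℝ :=
  let c : ℝ := 1 / ((N : ℝ) + 1)
  Matrix.of ![
    ![1, 0, -1, 0, -1, 0, 0, 0, 0, 0, 0, 0, 0, 0, 0, 0, 0, 0, 0, 0],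
    ![1, 0, 0, 0, 0, -2 * c, -c, c, 1, 0, 1, -2 * c, -c, c, 0, 0, 0, 0, 0, 0],
    ![1, 0, -1, 0, 0, -c, -c, 0, 0, 0, 1, -c, -c, 0, 0, 0, 0, 0, 0, 0],
    ![1, 0, 0, 0, -1, -c, 0, c, 1, 0, 0, -c, 0, c, 0, 0, 0, 0, 0, 0],
    ![0, 0, -1, 0, -1, c, 0, 0, 0, 0, 0, c, 0, 0, c, 0, c, 0, -1, 0],
    ![0, 0, 0, 0, 0, -c, -c, c, 1, 0, 1, -c, -c, c, c, 0, c, 0, -1, 0],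
    ![0, 0, -1, 0, 0, 0, -c, 0, 0, 0, 1, 0, -c, 0, c, 0, c, 0, -1, 0],
    ![0, 0, 0, 0, -1, 0, 0, c, 1, 0, 0, 0, 0, c, c, 0, c, 0, -1, 0]]

/-- Coordinates of the eight rows in a basis of the row space. -/
def Pmat : Matrix (Fin 8) (Fin 4) ℝ :=
  Matrix.of ![
    ![1, 0, 0, 0],
    ![1, 1, 1, 0],
    ![1, 1, 0, 0],
    ![1, 0, 1, 0],
    ![1, 0, 0, 1],
    ![1, 1, 1, 1],
    ![1, 1, 0, 1],
    ![1, 0, 1, 1]]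

/-- A basis of the row space (row 1, row 3 - row 1, row 4 - row 1, row 5 - row 1). -/
def Qmat (c : ℝ) : Matrix (Fin 4) (Fin 20) ℝ :=
  Matrix.of ![
    ![1, 0, -1, 0, -1, 0, 0, 0, 0, 0, 0, 0, 0, 0, 0, 0, 0, 0, 0, 0],
    ![0, 0, 0, 0, 1, -c, -c, 0, 0, 0, 1, -c, -c, 0, 0, 0, 0, 0, 0, 0],
    ![0, 0, 1, 0, 0, -c, 0, c, 1, 0, 0, -c, 0, c, 0, 0, 0, 0, 0, 0],
    ![-1, 0, 0, 0, 0, c, 0, 0, 0, 0, 0, c, 0, 0, c, 0, c, 0, -1, 0]]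

theorem Mmat_eq (N : ℕ) : Mmat N = Pmat * Qmat (1 / ((N : ℝ) + 1)) := by
  unfold Mmat Pmat Qmat
  generalize 1 / ((N : ℝ) + 1) = c
  ext i j
  fin_cases i <;> fin_cases j <;> simp [Matrix.mul_apply, Fin.sum_univ_four] <;> ring

theorem rank_ge (N : ℕ) : 4 ≤ (Mmat N).rank := by
  have h : LinearIndependent ℝ (fun k : Fin 4 => (Mmat N).row ((![0, 2, 3, 4] : Fin 4 → Fin 8) k)) := by
    rw [Fintype.linearIndependent_iff]
    intro g hg
    have h0 := congrFun hg 0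
    have h8 := congrFun hg 8
    have h10 := congrFun hg 10
    have h18 := congrFun hg 18
    simp [Fin.sum_univ_four, Mmat, Matrix.row] at h0 h8 h10 h18
    intro i
    fin_cases i <;> simp <;> linarith
  rw [Matrix.rank_eq_finrank_span_row]
  have h2 := finrank_span_eq_card h
  rw [Fintype.card_fin] at h2
  rw [← h2]
  apply Submodule.finrank_mono
  apply Submodule.span_mono
  rintro _ ⟨k, rfl⟩
  exact ⟨_, rfl⟩

/-- the coefficient matrix of the eight transformation rules has rank 4, i.e.
exactly four of them are linearly independent. -/
theorem stmt10 (N : ℕ) (hN : 2 ≤ N) : (Mmat N).rank = 4 := by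
  apply le_antisymm _ (rank_ge N)
  rw [Mmat_eq]
  refine (Matrix.rank_mul_le_left _ _).trans ?_
  exact (Matrix.rank_le_width _)
end
end

section
/- Under the stated hypotheses of an equitorsion third-type almost geodesic mapping with the property of reciprocity, for every p ∈ {1,…,8} the geometric object T̃_(p)^i_{jmn} = Γ^i_[jm];n − σ_(p)^i_{jmn} is an invariant of the mapping: the corresponding barred object T̄̃_(p)^i_{jmn} = Γ̄^i_[jm];̄n − σ̄_(p)^i_{jmn}, built from Γ̄, σ̄, φ̄, coincides with T̃_(p)^i_{jmn} at every point of U. -/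
open scoped BigOperators

noncomputable section

/-- for every `p` the geometric object
`T̃_(p)^i_{jmn} = Γ^i_[jm];n − σ_(p)^i_{jmn}` is an invariant of an equitorsion third-type
almost geodesic mapping with the property of reciprocity. -/
theorem stmt11 {N : ℕ} (hN : 2 ≤ N)
    (U : Set (Fin N → ℝ)) (hUopen : IsOpen U) (hUne : U.Nonempty)
    (Γ Γ' : (Fin N → ℝ) → Fin N → Fin N → Fin N → ℝ)
    (hΓ : ∀ i j k, ContDiffOn ℝ 2 (fun x => Γ x i j k) U)
    (hΓ' : ∀ i j k, ContDiffOn ℝ 2 (fun x => Γ' x i j k) U)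
    (ψ φ : (Fin N → ℝ) → Fin N → ℝ) (σ : (Fin N → ℝ) → Fin N → Fin N → ℝ)
    (ψ' φ' : (Fin N → ℝ) → Fin N → ℝ) (σ' : (Fin N → ℝ) → Fin N → Fin N → ℝ)
    (hψ : ∀ j, ContDiffOn ℝ 2 (fun x => ψ x j) U)
    (hφ : ∀ i, ContDiffOn ℝ 2 (fun x => φ x i) U)
    (hσ : ∀ j k, ContDiffOn ℝ 2 (fun x => σ x j k) U)
    (hσsym : ∀ x ∈ U, ∀ j k, σ x j k = σ x k j)
    (hψ' : ∀ j, ContDiffOn ℝ 2 (fun x => ψ' x j) U)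
    (hφ' : ∀ i, ContDiffOn ℝ 2 (fun x => φ' x i) U)
    (hσ' : ∀ j k, ContDiffOn ℝ 2 (fun x => σ' x j k) U)
    (hσ'sym : ∀ x ∈ U, ∀ j k, σ' x j k = σ' x k j)
    (hbasic : ∀ x ∈ U, ∀ i j k,
      Γ' x i j k = Γ x i j k + ψ x j * kd i k + ψ x k * kd i j + 2 * σ x j k * φ x i)
    (hrecip : ∀ x ∈ U, ∀ i j k,
      Γ x i j k = Γ' x i j k + ψ' x j * kd i k + ψ' x k * kd i j + 2 * σ' x j k * φ' x i)
    (hψneg : ∀ x ∈ U, ∀ j, ψ' x j = -ψ x j)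
    (hσφneg : ∀ x ∈ U, ∀ i j k, σ' x j k * φ' x i = -(σ x j k * φ x i)) :
    ∀ p : Fin 8, ∀ x ∈ U, ∀ i j m n : Fin N,
      covTor Γ' x i j m n - sigmaP Γ' σ' φ' p x i j m n =
        covTor Γ x i j m n - sigmaP Γ σ φ p x i j m n := by
  intro p x hx i j m n
  have hTy : ∀ y ∈ U, ∀ i j k, GamT Γ' y i j k = GamT Γ y i j k := by
    intro y hy i j k
    simp only [GamT, hbasic y hy, hσsym y hy k j]
    ring
  have hT := hTy x hx
  have hS : ∀ i j k, GamS Γ' x i j k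
      = GamS Γ x i j k + ψ x j * kd i k + ψ x k * kd i j + 2 * (σ x j k * φ x i) := by
    intro i j k
    simp only [GamS, hbasic x hx, hσsym x hx k j]
    ring
  have hs := hσφneg x hx
  have hanti : ∀ i j k, GamT Γ x i j k = - GamT Γ x i k j := by
    intro i j k
    simp only [GamT]
    ring
  have hp : pder (fun y => GamT Γ' y i j m) n x = pder (fun y => GamT Γ y i j m) n x := by
    unfold pder
    have : (fun y => GamT Γ' y i j m) =ᶠ[nhds x] (fun y => GamT Γ y i j m) := by
      filter_upwards [hUopen.mem_nhds hx] with y hy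
      exact hTy y hy i j m
    rw [this.fderiv_eq]
  have kd1 : ∀ (f : Fin N → ℝ) (a : Fin N), ∑ α, f α * kd α a = f a := by
    intro f a
    simp [kd]
  have kd2 : ∀ (f : Fin N → ℝ) (a : Fin N), ∑ α, f α * kd a α = f a := by
    intro f a
    simp [kd]
  -- contraction of the connection
  have htr : ∀ k, ∑ α, GamS Γ' x α k α
      = ∑ α, GamS Γ x α k α + ((N : ℝ) + 1) * ψ x k + 2 * ∑ α, φ x α * σ x α k := by
    intro k
    have h1 : ∑ α : Fin N, ψ x k * kd α α = N * ψ x k := by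
      simp [kd]
    have h2 : ∑ α, 2 * (σ x k α * φ x α) = 2 * ∑ α, φ x α * σ x α k := by
      rw [Finset.mul_sum]
      refine Finset.sum_congr rfl fun α _ => ?_
      rw [hσsym x hx k α]; ring
    simp only [hS, Finset.sum_add_distrib, h1, h2, kd1 (ψ x) k]
    ring
  have hf : ∀ k, ∑ α, φ' x α * σ' x α k = - ∑ α, φ x α * σ x α k := by
    intro k
    rw [← Finset.sum_neg_distrib]
    refine Finset.sum_congr rfl fun α _ => ?_
    rw [mul_comm, hs, mul_comm]
  have hf2 : ∀ k, ∑ α, φ x α * σ x k α = ∑ α, φ x α * σ x α k := fun k =>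
    Finset.sum_congr rfl fun α _ => by rw [hσsym x hx k α]
  have hf2' : ∀ k, ∑ α, φ' x α * σ' x k α = - ∑ α, φ x α * σ x α k := fun k => by
    rw [← hf]
    exact Finset.sum_congr rfl fun α _ => by rw [hσ'sym x hx k α]
  have u8 : (∑ α, GamT Γ x i α m * φ' x α) * σ' x j n
      = - ((∑ α, GamT Γ x i α m * φ x α) * σ x j n) := by
    rw [Finset.sum_mul, Finset.sum_mul, ← Finset.sum_neg_distrib]
    refine Finset.sum_congr rfl fun α _ => ?_
    linear_combination GamT Γ x i α m * hs α j n
  have u10 : (∑ α, GamT Γ x i j α * φ' x α) * σ' x m n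
      = - ((∑ α, GamT Γ x i j α * φ x α) * σ x m n) := by
    rw [Finset.sum_mul, Finset.sum_mul, ← Finset.sum_neg_distrib]
    refine Finset.sum_congr rfl fun α _ => ?_
    linear_combination GamT Γ x i j α * hs α m n
  have u18 : (∑ α, GamT Γ x α j m * σ' x α n) * φ' x i
      = - ((∑ α, GamT Γ x α j m * σ x α n) * φ x i) := by
    rw [Finset.sum_mul, Finset.sum_mul, ← Finset.sum_neg_distrib]
    refine Finset.sum_congr rfl fun α _ => ?_
    linear_combination GamT Γ x α j m * hs i α n
  have u0 : ∑ α, GamT Γ x α j m * GamS Γ' x i α n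
      = ∑ α, GamT Γ x α j m * GamS Γ x i α n + kd i n * (∑ α, GamT Γ x α j m * ψ x α)
        + ψ x n * GamT Γ x i j m + 2 * ((∑ α, GamT Γ x α j m * σ x α n) * φ x i) := by
    rw [← kd2 (fun α => GamT Γ x α j m) i]
    simp only [Finset.mul_sum, Finset.sum_mul, ← Finset.sum_add_distrib]
    refine Finset.sum_congr rfl fun α _ => ?_
    rw [hS]; ring
  have u2 : ∑ α, GamT Γ x i α m * GamS Γ' x α j n
      = ∑ α, GamT Γ x i α m * GamS Γ x α j n - ψ x j * GamT Γ x i m n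
        + ψ x n * GamT Γ x i j m + 2 * ((∑ α, GamT Γ x i α m * φ x α) * σ x j n) := by
    rw [hanti i m n, ← kd1 (fun α => GamT Γ x i α m) n, ← kd1 (fun α => GamT Γ x i α m) j]
    rw [mul_neg, sub_neg_eq_add]
    simp only [Finset.mul_sum, Finset.sum_mul, ← Finset.sum_add_distrib]
    refine Finset.sum_congr rfl fun α _ => ?_
    rw [hS]; ring
  have u4 : ∑ α, GamT Γ x i j α * GamS Γ' x α m n
      = ∑ α, GamT Γ x i j α * GamS Γ x α m n + ψ x m * GamT Γ x i j n
        + ψ x n * GamT Γ x i j m + 2 * ((∑ α, GamT Γ x i j α * φ x α) * σ x m n) := by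
    rw [← kd1 (fun α => GamT Γ x i j α) n, ← kd1 (fun α => GamT Γ x i j α) m]
    simp only [Finset.mul_sum, Finset.sum_mul, ← Finset.sum_add_distrib]
    refine Finset.sum_congr rfl fun α _ => ?_
    rw [hS]; ring
  have u14 : ∑ α, GamT Γ x α j m * ∑ β, GamS Γ' x β α β
      = ∑ α, GamT Γ x α j m * ∑ β, GamS Γ x β α β
        + ((N : ℝ) + 1) * (∑ α, GamT Γ x α j m * ψ x α)
        + 2 * ∑ α, GamT Γ x α j m * ∑ β, φ x β * σ x α β := by
    simp only [hf2, htr]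
    rw [Finset.mul_sum, Finset.mul_sum, ← Finset.sum_add_distrib, ← Finset.sum_add_distrib]
    refine Finset.sum_congr rfl fun α _ => ?_
    ring
  have u16 : ∑ α, GamT Γ x α j m * ∑ β, φ' x β * σ' x α β
      = - ∑ α, GamT Γ x α j m * ∑ β, φ x β * σ x α β := by
    simp only [hf2, hf2', mul_neg, Finset.sum_neg_distrib]
  have hcov : ∀ G : (Fin N → ℝ) → Fin N → Fin N → Fin N → ℝ, covTor G x i j m n
      = pder (fun y => GamT G y i j m) n x + (∑ α, GamT G x α j m * GamS G x i α n)
        - (∑ α, GamT G x i α m * GamS G x α j n)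
        - (∑ α, GamT G x i j α * GamS G x α m n) := by
    intro G
    simp only [covTor, mul_comm]
  have hc0 : ((N : ℝ) + 1) ≠ 0 := by positivity
  rw [hcov, hcov, hp]
  fin_cases p <;>
    simp [sigmaP, Uobj, hT] <;>
    (try simp only [u0, u2, u4, u8, u10, u18, u14, u16]) <;>
    (try simp only [htr, hf]) <;>
    field_simp <;> ring
end
end

section
/- Fix an integer N ≥ 2 and set c = 1/(N+1). For p = 1,…,8 let a^p ∈ ℝ^20 be the coefficient vector of σ_(p) with respect to the ordered list U1,…,U20, and let π : ℝ^20 → ℝ^20 be the signed permutation induced by interchanging the indices m and n in U1,…,U20 (π swaps coordinates 1 and 2, 3 and 4, 6 and 7, 9 and 10, 12 and 13, 15 and 16, 17 and 18, 19 and 20, negates coordinates 8 and 14, and fixes coordinates 5 and 11). Over the field F = ℝ(u, u', v, v', w) of rational functions in five indeterminates, define for each (p,q) ∈ {1,…,8}² the vector r_{p,q} ∈ F^26 whose coordinates are: 1 (the coefficient of the curvature tensor), then −(u · a^p_θ + u' · (π a^q)_θ) for θ = 1,…,20, then u, u', v, v', w. Then the 64 vectors r_{p,q} span an F-subspace of F^26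 of dimension exactly 6; i.e., among the families of invariants Wpqs of equitorsion third-type almost geodesic mappings there are exactly six linearly independent ones. -/
noncomputable section

/-- The field `F = ℝ(u, u', v, v', w)` of rational functions in five indeterminates. -/
abbrev F5 : Type := FractionRing (MvPolynomial (Fin 5) ℝ)

/-- Real scalars inside `F5`. -/
def toF5 (r : ℝ) : F5 := algebraMap (MvPolynomial (Fin 5) ℝ) F5 (MvPolynomial.C r)

/-- The five indeterminates `u, u', v, v', w` inside `F5`. -/
def var5 (k : Fin 5) : F5 := algebraMap (MvPolynomial (Fin 5) ℝ) F5 (MvPolynomial.X k)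

/-- The coefficient vectors `a^p` of `σ_(p)` with respect to `U1, …, U20`, `c = 1/(N+1)`. -/
def aCoeff (N : ℕ) : Fin 8 → Fin 20 → ℝ :=
  let c : ℝ := 1 / ((N : ℝ) + 1)
  ![
    ![1, 0, -1, 0, -1, 0, 0, 0, 0, 0, 0, 0, 0, 0, 0, 0, 0, 0, 0, 0],
    ![1, 0, 0, 0, 0, -2 * c, -c, c, 1, 0, 1, -2 * c, -c, c, 0, 0, 0, 0, 0, 0],
    ![1, 0, -1, 0, 0, -c, -c, 0, 0, 0, 1, -c, -c, 0, 0, 0, 0, 0, 0, 0],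
    ![1, 0, 0, 0, -1, -c, 0, c, 1, 0, 0, -c, 0, c, 0, 0, 0, 0, 0, 0],
    ![0, 0, -1, 0, -1, c, 0, 0, 0, 0, 0, c, 0, 0, c, 0, c, 0, -1, 0],
    ![0, 0, 0, 0, 0, -c, -c, c, 1, 0, 1, -c, -c, c, c, 0, c, 0, -1, 0],
    ![0, 0, -1, 0, 0, 0, -c, 0, 0, 0, 1, 0, -c, 0, c, 0, c, 0, -1, 0],
    ![0, 0, 0, 0, -1, 0, 0, c, 1, 0, 0, 0, 0, c, c, 0, c, 0, -1, 0]]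

/-- The signed permutation `π` of coefficient vectors induced by interchanging `m` and `n`. -/
def piPerm (a : Fin 20 → ℝ) : Fin 20 → ℝ :=
  ![a 1, a 0, a 3, a 2, a 4, a 6, a 5, -a 7, a 9, a 8, a 10, a 12, a 11, -a 13,
    a 15, a 14, a 17, a 16, a 19, a 18]

/-- The coefficient vector `r_{p,q} ∈ F5^26`: the coefficient `1` of the curvature tensor,
then `−(u·a^p_θ + u'·(π a^q)_θ)` for `θ = 1, …, 20`, then `u, u', v, v', w`. -/
def rVec (N : ℕ) (p q : Fin 8) : Fin 26 → F5 :=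
  let e : Fin 20 → F5 := fun θ =>
    -(var5 0 * toF5 (aCoeff N p θ) + var5 1 * toF5 (piPerm (aCoeff N q) θ))
  ![1, e 0, e 1, e 2, e 3, e 4, e 5, e 6, e 7, e 8, e 9, e 10, e 11, e 12, e 13,
    e 14, e 15, e 16, e 17, e 18, e 19, var5 0, var5 1, var5 2, var5 3, var5 4]

theorem toF5_add (a b : ℝ) : toF5 (a + b) = toF5 a + toF5 b := by simp [toF5]

theorem toF5_sub (a b : ℝ) : toF5 (a - b) = toF5 a - toF5 b := by simp [toF5]

theorem toF5_mul (a b : ℝ) : toF5 (a * b) = toF5 a * toF5 b := by simp [toF5]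

theorem toF5_neg (a : ℝ) : toF5 (-a) = -toF5 a := by simp [toF5]

theorem toF5_zero : toF5 0 = 0 := by simp [toF5]

theorem toF5_one : toF5 1 = 1 := by simp [toF5]

theorem var5_ne (k : Fin 5) : var5 k ≠ 0 := by
  unfold var5
  intro h
  rw [map_eq_zero_iff _ (IsFractionRing.injective (MvPolynomial (Fin 5) ℝ) F5)] at h
  exact MvPolynomial.X_ne_zero k h

/-- Coordinates of `a^p - a^1` along the three basic differences. -/
def alC : Fin 8 → ℝ := ![0, 1, 1, 0, 0, 1, 1, 0]
/-- Second coordinate. -/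
def beC : Fin 8 → ℝ := ![0, 1, 0, 1, 0, 1, 0, 1]
/-- Third coordinate. -/
def gaC : Fin 8 → ℝ := ![0, 0, 0, 0, 1, 1, 1, 1]

theorem aCoeff_decomp (N : ℕ) (p : Fin 8) : aCoeff N p = fun θ =>
    aCoeff N 0 θ + alC p * (aCoeff N 2 θ - aCoeff N 0 θ)
      + beC p * (aCoeff N 3 θ - aCoeff N 0 θ) + gaC p * (aCoeff N 4 θ - aCoeff N 0 θ) := by
  funext θ
  fin_cases p <;> fin_cases θ <;> simp [aCoeff, alC, beC, gaC] <;> ring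

theorem piPerm_decomp (N : ℕ) (p : Fin 8) (θ : Fin 20) : piPerm (aCoeff N p) θ =
    piPerm (aCoeff N 0) θ + alC p * (aCoeff N 2 θ - aCoeff N 0 θ)
      + beC p * (piPerm (aCoeff N 3) θ - piPerm (aCoeff N 0) θ)
      + gaC p * (piPerm (aCoeff N 4) θ - piPerm (aCoeff N 0) θ) := by
  have h : aCoeff N 2 θ - aCoeff N 0 θ = piPerm (aCoeff N 2) θ - piPerm (aCoeff N 0) θ := by
    fin_cases θ <;> simp [piPerm, aCoeff]
  rw [h, aCoeff_decomp N p]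
  fin_cases θ <;> simp [piPerm] <;> ring

/-- The six basis vectors. -/
def bVec (N : ℕ) : Fin 6 → Fin 26 → F5 :=
  ![rVec N 0 0, rVec N 2 0, rVec N 3 0, rVec N 4 0, rVec N 0 3, rVec N 0 4]

theorem entry_decomp (N : ℕ) (p q : Fin 8) (θ : Fin 20) (e : Fin 8 → Fin 8 → F5)
    (he : ∀ p q, e p q =
      -(var5 0 * toF5 (aCoeff N p θ) + var5 1 * toF5 (piPerm (aCoeff N q) θ))) :
    e p q = e 0 0 + (toF5 (alC p) + toF5 (alC q) * (var5 1 / var5 0)) * (e 2 0 - e 0 0)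
      + toF5 (beC p) * (e 3 0 - e 0 0) + toF5 (gaC p) * (e 4 0 - e 0 0)
      + toF5 (beC q) * (e 0 3 - e 0 0) + toF5 (gaC q) * (e 0 4 - e 0 0) := by
  have h0 := var5_ne 0
  simp only [he]
  rw [piPerm_decomp N q θ, congrFun (aCoeff_decomp N p) θ]
  simp only [toF5_add, toF5_sub, toF5_mul]
  field_simp
  ring

theorem rVec_decomp (N : ℕ) (p q : Fin 8) :
    rVec N p q = rVec N 0 0
      + (toF5 (alC p) + toF5 (alC q) * (var5 1 / var5 0)) • (rVec N 2 0 - rVec N 0 0)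
      + toF5 (beC p) • (rVec N 3 0 - rVec N 0 0) + toF5 (gaC p) • (rVec N 4 0 - rVec N 0 0)
      + toF5 (beC q) • (rVec N 0 3 - rVec N 0 0)
      + toF5 (gaC q) • (rVec N 0 4 - rVec N 0 0) := by
  funext i
  simp only [Pi.add_apply, Pi.smul_apply, Pi.sub_apply, smul_eq_mul]
  have key : (∃ θ : Fin 20, ∀ p q, rVec N p q i =
      -(var5 0 * toF5 (aCoeff N p θ) + var5 1 * toF5 (piPerm (aCoeff N q) θ))) ∨
      ∃ x, ∀ p q, rVec N p q i = x := by
    by_cases h : 1 ≤ i.val ∧ i.val ≤ 20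
    · left
      refine ⟨⟨i.val - 1, by omega⟩, fun p q => ?_⟩
      fin_cases i <;> first | (exfalso; revert h; decide) | rfl
    · right
      refine ⟨rVec N 0 0 i, fun p q => ?_⟩
      fin_cases i <;> first | (exfalso; revert h; decide) | simp [rVec]
  rcases key with ⟨θ, h⟩ | ⟨x, h⟩
  · exact entry_decomp N p q θ (fun p q => rVec N p q i) h
  · simp [h]

theorem bVec_indep (N : ℕ) : LinearIndependent F5 (bVec N) := by
  rw [Fintype.linearIndependent_iff]
  intro g hg
  have h0 := var5_ne 0
  have h1 := var5_ne 1
  have ev : ∀ i : Fin 26, g 0 * rVec N 0 0 i + g 1 * rVec N 2 0 i + g 2 * rVec N 3 0 i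
      + g 3 * rVec N 4 0 i + g 4 * rVec N 0 3 i + g 5 * rVec N 0 4 i = 0 := by
    intro i
    have := congrFun hg i
    simpa [Fin.sum_univ_six, bVec] using this
  have e0 := ev 0
  have e9 := ev 9
  have e10 := ev 10
  have e11 := ev 11
  have e19 := ev 19
  have e20 := ev 20
  simp [rVec, aCoeff, piPerm, toF5_zero, toF5_one, toF5_neg, h0, h1] at e0 e9 e10 e11 e19 e20
  intro i
  fin_cases i <;> simp_all

/-- the 64 coefficient vectors `r_{p,q}` span a subspace of `F5^26` of
dimension exactly 6: among the families of invariants `Wpqs` there are exactly six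
linearly independent ones. -/
theorem stmt17 (N : ℕ) (hN : 2 ≤ N) :
    Module.finrank F5
      (Submodule.span F5 (Set.range fun pq : Fin 8 × Fin 8 => rVec N pq.1 pq.2)) = 6 := by
  have hs : Submodule.span F5 (Set.range fun pq : Fin 8 × Fin 8 => rVec N pq.1 pq.2) =
      Submodule.span F5 (Set.range (bVec N)) := by
    apply le_antisymm
    · rw [Submodule.span_le]
      rintro _ ⟨⟨p, q⟩, rfl⟩
      have hb : ∀ i, bVec N i ∈ Submodule.span F5 (Set.range (bVec N)) :=
        fun i => Submodule.subset_span ⟨i, rfl⟩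
      have b0 : rVec N 0 0 ∈ Submodule.span F5 (Set.range (bVec N)) := hb 0
      have d : ∀ i, ∀ c : F5, c • (bVec N i - rVec N 0 0) ∈
          Submodule.span F5 (Set.range (bVec N)) :=
        fun i c => Submodule.smul_mem _ _ (Submodule.sub_mem _ (hb i) b0)
      simp only [SetLike.mem_coe]
      rw [rVec_decomp N p q]
      exact Submodule.add_mem _ (Submodule.add_mem _ (Submodule.add_mem _ (Submodule.add_mem _
        (Submodule.add_mem _ b0 (d 1 _)) (d 2 _)) (d 3 _)) (d 4 _)) (d 5 _)
    · rw [Submodule.span_le]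
      rintro _ ⟨i, rfl⟩
      have hr : ∀ p q, rVec N p q ∈ Submodule.span F5
          (Set.range fun pq : Fin 8 × Fin 8 => rVec N pq.1 pq.2) :=
        fun p q => Submodule.subset_span ⟨(p, q), rfl⟩
      fin_cases i
      · exact hr 0 0
      · exact hr 2 0
      · exact hr 3 0
      · exact hr 4 0
      · exact hr 0 3
      · exact hr 0 4
  rw [hs, finrank_span_eq_card (bVec_indep N)]
  simp
end
end
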